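/- arXiv:1709.07290 — 2 statements merged into one kernel-verified Lean document; each statement's English description precedes it below -/
import Mathlib

section
/- Let Ω be a finite set, π a probability distribution on Ω that is strictly positive everywhere, L a finite index set with probability distribution ρ, and for each a ∈ L let R_a be a partition of Ω. For each block R (of any partition R_a) let P_R be an |Ω|×|Ω| matrix that is zero outside the rows and columns of R and whose restriction to R×R is the transition matrix of an ergodic, time-reversible Markov chain on R with stationary distribution π(x)/π(R) for x ∈ R; denote its eigenvalues 1 = λ_0^R ≥ λ_1^R ≥ … ≥ λ_{|R|−1}^R. Let P = Σ_{a∈L} ρ(a) Σ_{R∈R_a} P_R (assumed ergodic) and let P_heat = Σ_{a∈L} ρ(a) Σ_{R∈R_a} 1·σ_R, where σ_R is the row vector with σ_R(x) = π(x)/π(R) for x ∈ R and 0 otherwise and 1 is the all-ones column vector. If α, β are non-zero real constants with α·β > 0 such that for every block R and every i = 1,…,|R|−1 both λ_i^R ≥ 0 and α − β(1 − λ_i^R) ≥ 0, then (1/α)·(1 − λ_*^{heat})^{-1} ≤ (1/β)·(1 − λ_*)^{-1}, where λ_*^{heat} and λ_* are the second-largest eigenvalues of P_heat and P respectively; moreover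 P and P_heat have only non-negative eigenvalues. In particular, if λ_{|R|−1}^R ≥ 0 for every block R, then (1 − λ_*^{heat})^{-1} ≤ (1 − λ_*)^{-1}. -/
open Finset

/-- The restriction of a matrix `M` on `Ω` to the rows and columns of `R ⊆ Ω`. -/
def restrictTo {Ω : Type*} (R : Finset Ω) (M : Matrix Ω Ω ℝ) :
    Matrix {x // x ∈ R} {x // x ∈ R} ℝ :=
  Matrix.of fun x y => M x.val y.val

/-- weighted inner product -/
noncomputable def wip {n : Type*} [Fintype n] (w : n → ℝ) (f g : n → ℝ) : ℝ := ∑ x, w x * f x * g x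

lemma wip_comm {n : Type*} [Fintype n] (w f g : n → ℝ) : wip w f g = wip w g f := by
  unfold wip; exact Finset.sum_congr rfl fun x _ => by ring

lemma wip_add_left {n : Type*} [Fintype n] (w f g h : n → ℝ) :
    wip w (f + g) h = wip w f h + wip w g h := by
  unfold wip; rw [← Finset.sum_add_distrib]; exact Finset.sum_congr rfl fun x _ => by simp; ring

lemma wip_smul_left {n : Type*} [Fintype n] (w f h : n → ℝ) (c : ℝ) :
    wip w (c • f) h = c * wip w f h := by
  unfold wip; rw [Finset.mul_sum]; exact Finset.sum_congr rfl fun x _ => by simp; ring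

lemma wip_add_right {n : Type*} [Fintype n] (w f g h : n → ℝ) :
    wip w h (f + g) = wip w h f + wip w h g := by
  rw [wip_comm, wip_add_left, wip_comm w f, wip_comm w g]

lemma wip_smul_right {n : Type*} [Fintype n] (w f h : n → ℝ) (c : ℝ) :
    wip w h (c • f) = c * wip w h f := by
  rw [wip_comm, wip_smul_left, wip_comm]

lemma wip_sum_left {n ι : Type*} [Fintype n] [Fintype ι] (w : n → ℝ) (f : ι → n → ℝ) (h : n → ℝ) :
    wip w (∑ i, f i) h = ∑ i, wip w (f i) h := by
  unfold wip; rw [Finset.sum_comm]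
  refine Finset.sum_congr rfl fun x _ => ?_
  rw [Finset.sum_apply, Finset.mul_sum, Finset.sum_mul]

lemma wip_self_nonneg {n : Type*} [Fintype n] (w f : n → ℝ) (hw : ∀ x, 0 < w x) :
    0 ≤ wip w f f := by
  unfold wip
  exact Finset.sum_nonneg fun x _ => by
    have := mul_nonneg (hw x).le (mul_self_nonneg (f x)); linarith [mul_assoc (w x) (f x) (f x)]

lemma wip_self_pos {n : Type*} [Fintype n] (w f : n → ℝ) (hw : ∀ x, 0 < w x) (hf : f ≠ 0) :
    0 < wip w f f := by
  obtain ⟨x, hx⟩ := Function.ne_iff.mp hf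
  unfold wip
  refine Finset.sum_pos' (fun x _ => ?_) ⟨x, mem_univ _, ?_⟩
  · have := mul_nonneg (hw x).le (mul_self_nonneg (f x)); linarith [mul_assoc (w x) (f x) (f x)]
  · have := mul_pos (hw x) (mul_self_pos.mpr hx); linarith [mul_assoc (w x) (f x) (f x)]

lemma wip_mulVec_eq {n : Type*} [Fintype n] (w f g : n → ℝ) (M : Matrix n n ℝ) :
    wip w f (M.mulVec g) = ∑ x, ∑ y, w x * M x y * f x * g y := by
  unfold wip Matrix.mulVec dotProduct
  refine Finset.sum_congr rfl fun x _ => ?_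
  rw [Finset.mul_sum]; exact Finset.sum_congr rfl fun y _ => by ring

lemma wip_mulVec_symm {n : Type*} [Fintype n] (w f g : n → ℝ) (M : Matrix n n ℝ)
    (hrev : ∀ x y, w x * M x y = w y * M y x) :
    wip w f (M.mulVec g) = wip w (M.mulVec f) g := by
  rw [wip_comm w (M.mulVec f), wip_mulVec_eq, wip_mulVec_eq, Finset.sum_comm]
  refine Finset.sum_congr rfl fun x _ => Finset.sum_congr rfl fun y _ => ?_
  rw [hrev y x]; ring

lemma spectral_rev {n : Type*} [Fintype n] [DecidableEq n] (w : n → ℝ) (hw : ∀ x, 0 < w x)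
    (M : Matrix n n ℝ) (hrev : ∀ x y, w x * M x y = w y * M y x) :
    ∃ (l : n → ℝ) (e : n → n → ℝ), M.charpoly.roots = univ.val.map l ∧
      (∀ i, M.mulVec (e i) = l i • e i) ∧
      (∀ i j, wip w (e i) (e j) = if i = j then 1 else 0) ∧
      (∀ f, f = ∑ i, wip w (e i) f • e i) := by
  set s : n → ℝ := fun x => Real.sqrt (w x) with hs
  have hs0 : ∀ x, s x ≠ 0 := fun x => (Real.sqrt_pos.mpr (hw x)).ne'
  have hss : ∀ x, s x * s x = w x := fun x => Real.mul_self_sqrt (hw x).le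
  set A : Matrix n n ℝ := Matrix.diagonal s * (M * Matrix.diagonal (fun x => (s x)⁻¹)) with hA'
  have hAe : ∀ x y, A x y = s x * M x y * (s y)⁻¹ := by
    intro x y
    rw [hA', Matrix.diagonal_mul, Matrix.mul_diagonal]; ring
  have hA : A.IsHermitian := by
    ext x y
    rw [Matrix.conjTranspose_apply, hAe, hAe, star_trivial]
    have h := hrev x y
    rw [← hss, ← hss] at h
    field_simp [hs0]
    have := hs0 x; have := hs0 y
    linear_combination -h
  have hchar : A.charpoly = M.charpoly := by
    rw [hA', Matrix.charpoly_mul_comm, mul_assoc, Matrix.diagonal_mul_diagonal]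
    have : (fun i => (s i)⁻¹ * s i) = fun _ => 1 := by funext i; exact inv_mul_cancel₀ (hs0 i)
    rw [this, Matrix.diagonal_one, mul_one]
  refine ⟨hA.eigenvalues, fun i x => (s x)⁻¹ * hA.eigenvectorBasis i x, ?_, ?_, ?_, ?_⟩
  · rw [← hchar, hA.roots_charpoly_eq_eigenvalues]; rfl
  · intro i
    funext x
    have h := congrFun (hA.mulVec_eigenvectorBasis i) x
    simp only [Matrix.mulVec, dotProduct, Pi.smul_apply, smul_eq_mul, hAe] at h ⊢
    have : s x * ∑ y, M x y * ((s y)⁻¹ * hA.eigenvectorBasis i y)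
        = hA.eigenvalues i * hA.eigenvectorBasis i x := by
      rw [← h, Finset.mul_sum]; exact Finset.sum_congr rfl fun y _ => by ring
    apply mul_left_cancel₀ (hs0 x)
    rw [this]
    have h0 := hs0 x
    field_simp
  · intro i j
    have h := hA.eigenvectorBasis.inner_eq_ite i j
    rw [← h, EuclideanSpace.inner_eq_star_dotProduct]
    simp only [wip, dotProduct, ← hss]
    refine Finset.sum_congr rfl fun x _ => ?_
    have := hs0 x
    simp
    field_simp
  · intro f
    have h := hA.eigenvectorBasis.sum_repr' (WithLp.toLp 2 fun x => s x * f x)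
    have h2 : ∀ i, inner ℝ (hA.eigenvectorBasis i) (WithLp.toLp 2 fun x => s x * f x)
        = wip w (fun x => (s x)⁻¹ * hA.eigenvectorBasis i x) f := by
      intro i
      rw [EuclideanSpace.inner_eq_star_dotProduct]
      simp only [wip, dotProduct, ← hss]
      refine Finset.sum_congr rfl fun x _ => ?_
      have := hs0 x
      simp
      field_simp
    simp only [h2] at h
    funext x
    have hx := congrArg (fun v : EuclideanSpace ℝ n => v x) h
    simp at hx
    rw [Finset.sum_apply]
    simp only [Pi.smul_apply, smul_eq_mul]
    have h0 := hs0 x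
    apply mul_left_cancel₀ h0
    rw [← hx, Finset.mul_sum]
    refine Finset.sum_congr rfl fun i _ => ?_
    field_simp

lemma wip_expand {n : Type*} [Fintype n] (w : n → ℝ) (e : n → n → ℝ)
    (hc : ∀ f, f = ∑ i, wip w (e i) f • e i) (f g : n → ℝ) :
    wip w f g = ∑ i, wip w (e i) f * wip w (e i) g := by
  conv_lhs => rw [hc f]
  rw [wip_sum_left]
  exact Finset.sum_congr rfl fun i _ => by rw [wip_smul_left]

lemma wip_eig {n : Type*} [Fintype n] (w : n → ℝ) (M : Matrix n n ℝ)
    (hrev : ∀ x y, w x * M x y = w y * M y x) (e f : n → ℝ) (l : ℝ)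
    (he : M.mulVec e = l • e) : wip w e (M.mulVec f) = l * wip w e f := by
  rw [wip_mulVec_symm w e f M hrev, he, wip_smul_left]

lemma wip_expandM {n : Type*} [Fintype n] (w : n → ℝ) (M : Matrix n n ℝ)
    (hrev : ∀ x y, w x * M x y = w y * M y x) (l : n → ℝ) (e : n → n → ℝ)
    (he : ∀ i, M.mulVec (e i) = l i • e i)
    (hc : ∀ f, f = ∑ i, wip w (e i) f • e i) (f : n → ℝ) :
    wip w f (M.mulVec f) = ∑ i, l i * wip w (e i) f ^ 2 := by
  rw [wip_expand w e hc]
  refine Finset.sum_congr rfl fun i _ => ?_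
  rw [wip_eig w M hrev _ _ _ (he i)]; ring

lemma pick_two {n : Type*} [Fintype n] [DecidableEq n] (l : n → ℝ) (lam : ℕ → ℝ) (N : ℕ)
    (hN : 2 ≤ N) (hanti : Antitone lam)
    (h : univ.val.map l = (Multiset.range N).map lam) :
    ∃ i0 i1, i0 ≠ i1 ∧ l i0 = lam 0 ∧ l i1 = lam 1 ∧ ∀ i, i ≠ i0 → l i ≤ lam 1 := by
  obtain ⟨m, rfl⟩ : ∃ m, N = m + 1 := ⟨N - 1, by omega⟩
  have hr : (Multiset.range (m+1)).map lam
      = lam 0 ::ₘ (Multiset.range m).map (fun k => lam (k+1)) := by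
    rw [← Multiset.coe_range, List.range_succ_eq_map, ← Multiset.coe_range]
    simp [Function.comp_def]
  have h0 : lam 0 ∈ univ.val.map l := by rw [h, hr]; exact Multiset.mem_cons_self _ _
  obtain ⟨i0, -, hi0⟩ := Multiset.mem_map.mp h0
  have hu : (univ : Finset n).val = i0 ::ₘ (univ.erase i0).val := by
    rw [Finset.erase_val]; exact (Multiset.cons_erase (mem_univ i0)).symm
  rw [hu, hr, Multiset.map_cons, hi0, Multiset.cons_inj_right] at h
  have h1 : lam 1 ∈ (univ.erase i0).val.map l := by
    rw [h]; exact Multiset.mem_map.mpr ⟨0, Multiset.mem_range.mpr (by omega), rfl⟩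
  obtain ⟨i1, hi1, hl1⟩ := Multiset.mem_map.mp h1
  refine ⟨i0, i1, fun hh => (Finset.ne_of_mem_erase hi1) hh.symm, hi0, hl1, fun i hi => ?_⟩
  have : l i ∈ (univ.erase i0).val.map l :=
    Multiset.mem_map.mpr ⟨i, Finset.mem_erase.mpr ⟨hi, mem_univ _⟩, rfl⟩
  rw [h] at this
  obtain ⟨k, -, hk⟩ := Multiset.mem_map.mp this
  rw [← hk]; exact hanti (by omega)

/-- second eigenvalue: variational facts -/
lemma second_eig {n : Type*} [Fintype n] [DecidableEq n] (hcard : 2 ≤ Fintype.card n)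
    (w : n → ℝ) (hw : ∀ x, 0 < w x)
    (M : Matrix n n ℝ) (hrev : ∀ x y, w x * M x y = w y * M y x) (h1 : M.mulVec 1 = 1)
    (lam : ℕ → ℝ) (hanti : Antitone lam) (hlam0 : lam 0 = 1)
    (hroots : M.charpoly.roots = (Multiset.range (Fintype.card n)).map lam) :
    (∀ f, wip w 1 f = 0 → wip w f (M.mulVec f) ≤ lam 1 * wip w f f) ∧
    ∃ f, f ≠ 0 ∧ wip w 1 f = 0 ∧ lam 1 * wip w f f ≤ wip w f (M.mulVec f) ∧
      (lam 1 = 1 → M.mulVec f = f) := by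
  obtain ⟨l, e, hl, he, ho, hc⟩ := spectral_rev w hw M hrev
  obtain ⟨i0, i1, hne, hi0, hi1, hle⟩ := pick_two l lam _ hcard hanti (hl.symm.trans hroots)
  have hl1 : lam 1 ≤ 1 := hlam0 ▸ hanti (by omega)
  have : Nonempty n := ⟨i0⟩
  constructor
  · intro f hf
    rw [wip_expandM w M hrev l e he hc, wip_expand w e hc f f, Finset.mul_sum]
    refine Finset.sum_le_sum fun i _ => ?_
    by_cases hi : i = i0
    · subst hi
      rcases hl1.eq_or_lt with h | h
      · rw [h, hi0, hlam0]; nlinarith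
      · have hz : ∀ j, j ≠ i → wip w (e j) 1 = 0 := by
          intro j hj
          have h2 := wip_eig w M hrev (e j) 1 (l j) (he j)
          rw [h1] at h2
          have h3 := hle j hj
          have : (1 - l j) * wip w (e j) 1 = 0 := by linarith
          rcases mul_eq_zero.mp this with h | h
          · linarith
          · exact h
        have hA := wip_expand w e hc 1 f
        have hB := wip_expand w e hc 1 1
        rw [Finset.sum_eq_single i (fun j _ hj => by rw [hz j hj, zero_mul]) (by simp)] at hA hB
        have hpos := wip_self_pos w 1 hw one_ne_zero
        rw [hf] at hA
        have : wip w (e i) f = 0 := by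
          rcases mul_eq_zero.mp hA.symm with h | h
          · rw [h] at hB; linarith
          · exact h
        rw [this]; simp
    · have := mul_le_mul_of_nonneg_right (hle i hi) (sq_nonneg (wip w (e i) f))
      linarith
  · have key : ∀ a b : ℝ, lam 1 * wip w (a • e i0 + b • e i1) (a • e i0 + b • e i1) ≤
        wip w (a • e i0 + b • e i1) (M.mulVec (a • e i0 + b • e i1)) := by
      intro a b
      rw [Matrix.mulVec_add, Matrix.mulVec_smul, Matrix.mulVec_smul, he, he]
      simp only [wip_add_left, wip_add_right, wip_smul_left, wip_smul_right, ho, hne, hne.symm,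
        if_true, if_false, hi0, hi1, hlam0]
      nlinarith [mul_nonneg (sq_nonneg a) (sub_nonneg.mpr hl1)]
    have key2 : ∀ a b : ℝ, lam 1 = 1 → M.mulVec (a • e i0 + b • e i1) = a • e i0 + b • e i1 := by
      intro a b h
      rw [Matrix.mulVec_add, Matrix.mulVec_smul, Matrix.mulVec_smul, he, he, hi0, hi1, hlam0, h]
      simp
    have hnorm : ∀ a b : ℝ, wip w (a • e i0 + b • e i1) (a • e i0 + b • e i1) = a ^ 2 + b ^ 2 := by
      intro a b
      simp only [wip_add_left, wip_add_right, wip_smul_left, wip_smul_right, ho, hne, hne.symm,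
        if_true, if_false]
      ring
    have hperp : ∀ a b : ℝ, wip w 1 (a • e i0 + b • e i1)
        = a * wip w 1 (e i0) + b * wip w 1 (e i1) := by
      intro a b
      rw [wip_add_right, wip_smul_right, wip_smul_right]
    have hex : ∃ a b : ℝ, 0 < a ^ 2 + b ^ 2 ∧ a * wip w 1 (e i0) + b * wip w 1 (e i1) = 0 := by
      by_cases h : wip w 1 (e i1) = 0
      · exact ⟨0, 1, by norm_num, by rw [h]; ring⟩
      · exact ⟨wip w 1 (e i1), - wip w 1 (e i0), by positivity, by ring⟩
    obtain ⟨a, b, hab, hp⟩ := hex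
    refine ⟨a • e i0 + b • e i1, ?_, by rw [hperp, hp], key a b, key2 a b⟩
    intro h
    have h2 := hnorm a b
    rw [h] at h2
    simp [wip] at h2
    linarith

lemma gap_compare {n : Type*} [Fintype n] [DecidableEq n] (hcard : 2 ≤ Fintype.card n)
    (w : n → ℝ) (hw : ∀ x, 0 < w x)
    (M N : Matrix n n ℝ) (hM : ∀ x y, w x * M x y = w y * M y x) (hM1 : M.mulVec 1 = 1)
    (hN : ∀ x y, w x * N x y = w y * N y x) (hN1 : N.mulVec 1 = 1)
    (lam lamN : ℕ → ℝ) (hanti : Antitone lam) (hlam0 : lam 0 = 1)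
    (hroots : M.charpoly.roots = (Multiset.range (Fintype.card n)).map lam)
    (hantiN : Antitone lamN) (hlamN0 : lamN 0 = 1)
    (hrootsN : N.charpoly.roots = (Multiset.range (Fintype.card n)).map lamN)
    (a b : ℝ) (ha : 0 < a) (hb : 0 < b)
    (hcmp : ∀ f, b * (wip w f f - wip w f (M.mulVec f)) ≤ a * (wip w f f - wip w f (N.mulVec f))) :
    b * (1 - lam 1) ≤ a * (1 - lamN 1) := by
  obtain ⟨hA, -⟩ := second_eig hcard w hw M hM hM1 lam hanti hlam0 hroots
  obtain ⟨-, f, hf, hf1, hB, -⟩ := second_eig hcard w hw N hN hN1 lamN hantiN hlamN0 hrootsN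
  have hpos := wip_self_pos w f hw hf
  have h1 := mul_le_mul_of_nonneg_left (hA f hf1) hb.le
  have h2 := mul_le_mul_of_nonneg_left hB ha.le
  have h3 := hcmp f
  refine le_of_mul_le_mul_right ?_ hpos
  linarith

lemma fixed_const {Ω : Type*} [Fintype Ω] [DecidableEq Ω] (R : Finset Ω) (M : Matrix Ω Ω ℝ)
    (herg : ∃ T : ℕ, ∀ t ≥ T, ∀ x ∈ R, ∀ y ∈ R, 0 < (M ^ t) x y)
    (hsupp : ∀ x y, (x ∉ R ∨ y ∉ R) → M x y = 0)
    (hst : ∀ x ∈ R, ∑ y ∈ R, M x y = 1) (g : Ω → ℝ) (hg0 : ∀ x, x ∉ R → g x = 0)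
    (hg : M.mulVec g = g) : ∃ c, ∀ x ∈ R, g x = c := by
  rcases R.eq_empty_or_nonempty with rfl | hne
  · exact ⟨0, by simp⟩
  obtain ⟨T, hT⟩ := herg
  have hpow : ∀ (h : Ω → ℝ), M.mulVec h = h → ∀ t, (M ^ t).mulVec h = h := by
    intro h hh t
    induction t with
    | zero => simp
    | succ k ih => rw [pow_succ, ← Matrix.mulVec_mulVec, hh, ih]
  have hind : M.mulVec (fun x => if x ∈ R then 1 else 0) = fun x => if x ∈ R then 1 else 0 := by
    funext x
    simp only [Matrix.mulVec, dotProduct, mul_ite, mul_one, mul_zero]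
    rw [Finset.sum_ite_mem, Finset.univ_inter]
    split_ifs with hx
    · exact hst x hx
    · exact Finset.sum_eq_zero fun y _ => hsupp x y (Or.inl hx)
  obtain ⟨x0, hx0, hmax⟩ := R.exists_max_image g hne
  refine ⟨g x0, fun y hy => ?_⟩
  have e1 := congrFun (hpow _ hind T) x0
  have e2 := congrFun (hpow _ hg T) x0
  simp only [Matrix.mulVec, dotProduct, mul_ite, mul_one, mul_zero] at e1 e2
  rw [Finset.sum_ite_mem, Finset.univ_inter, if_pos hx0] at e1
  rw [← Finset.sum_subset (Finset.subset_univ R)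
    (fun z _ hz => by rw [hg0 z hz, mul_zero])] at e2
  have hs : ∑ z ∈ R, (M ^ T) x0 z * (g x0 - g z) = 0 := by
    simp only [mul_sub, Finset.sum_sub_distrib, ← Finset.sum_mul, e1, e2]; ring
  have hz := (Finset.sum_eq_zero_iff_of_nonneg (fun z hz =>
    mul_nonneg (hT T le_rfl x0 hx0 z hz).le (sub_nonneg.mpr (hmax z hz)))).mp hs y hy
  rcases mul_eq_zero.mp hz with h | h
  · exact absurd h (hT T le_rfl x0 hx0 y hy).ne'
  · linarith

/-- one block, zero-mean functions -/
lemma block_zero_mean {n : Type*} [Fintype n] [DecidableEq n] (w : n → ℝ) (hw : ∀ x, 0 < w x)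
    (M : Matrix n n ℝ) (hrev : ∀ x y, w x * M x y = w y * M y x)
    (hfix : ∀ g, M.mulVec g = g → ∃ c : ℝ, g = c • 1) (a b : ℝ)
    (hblock : ∀ μ ∈ M.charpoly.roots, μ ≠ 1 → 0 ≤ a - b * (1 - μ))
    (f : n → ℝ) (hf : wip w 1 f = 0) :
    b * (wip w f f - wip w f (M.mulVec f)) ≤ a * wip w f f := by
  obtain ⟨l, e, hl, he, ho, hc⟩ := spectral_rev w hw M hrev
  rw [wip_expandM w M hrev l e he hc, wip_expand w e hc f f, ← Finset.sum_sub_distrib,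
    Finset.mul_sum, Finset.mul_sum]
  refine Finset.sum_le_sum fun i _ => ?_
  by_cases h1 : l i = 1
  · obtain ⟨c, hcc⟩ := hfix (e i) (by rw [he, h1, one_smul])
    rw [hcc, wip_smul_left, hf]; simp
  · have := hblock (l i) (by rw [hl]; exact Multiset.mem_map.mpr ⟨i, mem_univ_val i, rfl⟩) h1
    nlinarith [mul_nonneg this (sq_nonneg (wip w (e i) f))]

/-- one block, general functions -/
lemma block_general {n : Type*} [Fintype n] [DecidableEq n] (w : n → ℝ) (hw : ∀ x, 0 < w x)
    (M : Matrix n n ℝ) (hrev : ∀ x y, w x * M x y = w y * M y x) (hM1 : M.mulVec 1 = 1)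
    (hfix : ∀ g, M.mulVec g = g → ∃ c : ℝ, g = c • 1) (a b : ℝ)
    (hblock : ∀ μ ∈ M.charpoly.roots, μ ≠ 1 → 0 ≤ a - b * (1 - μ))
    (f : n → ℝ) :
    b * (wip w f f - wip w f (M.mulVec f)) ≤ a * (wip w f f - wip w 1 f ^ 2 / wip w 1 1) := by
  rcases isEmpty_or_nonempty n with hn | hn
  · simp [wip]
  have hpos := wip_self_pos w (1 : n → ℝ) hw one_ne_zero
  set m := wip w 1 f / wip w 1 1 with hm
  have hmm : wip w 1 f = m * wip w 1 1 := by rw [hm]; field_simp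
  have hh : wip w 1 (f + (-m) • 1) = 0 := by
    rw [wip_add_right, wip_smul_right, hmm]; ring
  have h := block_zero_mean w hw M hrev hfix a b hblock _ hh
  have e3 : wip w f 1 = m * wip w 1 1 := by rw [wip_comm, hmm]
  have e4 : wip w 1 (M.mulVec f) = m * wip w 1 1 := by
    rw [wip_mulVec_symm w _ _ M hrev, hM1, hmm]
  rw [Matrix.mulVec_add, Matrix.mulVec_smul, hM1] at h
  simp only [wip_add_left, wip_add_right, wip_smul_left, wip_smul_right, e3, e4, hmm] at h
  have e5 : wip w 1 f ^ 2 / wip w 1 1 = m ^ 2 * wip w 1 1 := by rw [hmm]; field_simp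
  rw [e5]
  linarith

lemma restrict_mulVec {Ω : Type*} [Fintype Ω] [DecidableEq Ω] (R : Finset Ω) (M : Matrix Ω Ω ℝ)
    (hsupp : ∀ x y, (x ∉ R ∨ y ∉ R) → M x y = 0) (g : Ω → ℝ) (x : {x // x ∈ R}) :
    (restrictTo R M).mulVec (fun z => g z.val) x = M.mulVec g x.val := by
  simp only [Matrix.mulVec, dotProduct, restrictTo, Matrix.of_apply]
  rw [Finset.sum_coe_sort R (fun y => M x.val y * g y)]
  exact Finset.sum_subset (Finset.subset_univ R)
    (fun z _ hz => by rw [hsupp _ z (Or.inr hz), zero_mul])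

lemma block_omega {Ω : Type*} [Fintype Ω] [DecidableEq Ω] (π : Ω → ℝ) (hπ : ∀ x, 0 < π x)
    (R : Finset Ω) (M : Matrix Ω Ω ℝ)
    (hsupp : ∀ x y, (x ∉ R ∨ y ∉ R) → M x y = 0)
    (hst : ∀ x ∈ R, ∑ y ∈ R, M x y = 1)
    (hrev : ∀ x y, π x * M x y = π y * M y x)
    (herg : ∃ T : ℕ, ∀ t ≥ T, ∀ x ∈ R, ∀ y ∈ R, 0 < (M ^ t) x y) (a b : ℝ)
    (hblock : ∀ μ ∈ (restrictTo R M).charpoly.roots, μ ≠ 1 → 0 ≤ a - b * (1 - μ)) (g : Ω → ℝ) :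
    b * (∑ x ∈ R, π x * g x * g x - wip π g (M.mulVec g)) ≤
      a * (∑ x ∈ R, π x * g x * g x - (∑ x ∈ R, π x * g x) ^ 2 / ∑ x ∈ R, π x) := by
  have hM1 : (restrictTo R M).mulVec 1 = 1 := by
    funext x
    simp only [Matrix.mulVec, dotProduct, restrictTo, Matrix.of_apply, Pi.one_apply, mul_one]
    rw [Finset.sum_coe_sort R (fun y => M x.val y)]
    exact hst x.val x.2
  have hfix : ∀ g, (restrictTo R M).mulVec g = g → ∃ c : ℝ, g = c • 1 := by
    intro f hf
    set G : Ω → ℝ := fun x => if h : x ∈ R then f ⟨x, h⟩ else 0 with hG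
    have hGf : (fun z : {x // x ∈ R} => G z.val) = f := by
      funext z; simp [hG]
    obtain ⟨c, hc⟩ := fixed_const R M herg hsupp hst G (fun x hx => by simp [hG, hx]) (by
      funext x
      by_cases hx : x ∈ R
      · have := restrict_mulVec R M hsupp G ⟨x, hx⟩
        rw [hGf, hf] at this
        rw [← this]; simp [hG, hx]
      · simp only [Matrix.mulVec, dotProduct]
        rw [Finset.sum_eq_zero fun y _ => by rw [hsupp x y (Or.inl hx), zero_mul]]
        simp [hG, hx])
    refine ⟨c, ?_⟩
    rw [← hGf]; funext z; simp [hc z.val z.2]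
  have h := block_general (fun x : {x // x ∈ R} => π x.val) (fun x => hπ x.val) (restrictTo R M)
    (fun x y => hrev x.val y.val) hM1 hfix a b hblock (fun x => g x.val)
  have e1 : wip (fun x : {x // x ∈ R} => π x.val) (fun x => g x.val) (fun x => g x.val)
      = ∑ x ∈ R, π x * g x * g x := by
    unfold wip; exact Finset.sum_coe_sort R (fun x => π x * g x * g x)
  have e2 : wip (fun x : {x // x ∈ R} => π x.val) (fun x => g x.val)
      ((restrictTo R M).mulVec (fun x => g x.val)) = wip π g (M.mulVec g) := by
    unfold wip
    simp only [restrict_mulVec R M hsupp]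
    rw [Finset.sum_coe_sort R (fun x => π x * g x * M.mulVec g x)]
    refine Finset.sum_subset (Finset.subset_univ R) (fun z _ hz => ?_)
    simp only [Matrix.mulVec, dotProduct]
    rw [Finset.sum_eq_zero fun y _ => by rw [hsupp z y (Or.inl hz), zero_mul], mul_zero]
  have e3 : wip (fun x : {x // x ∈ R} => π x.val) 1 (fun x => g x.val) = ∑ x ∈ R, π x * g x := by
    unfold wip; simp only [Pi.one_apply, mul_one]
    exact Finset.sum_coe_sort R (fun x => π x * g x)
  have e4 : wip (fun x : {x // x ∈ R} => π x.val) 1 1 = ∑ x ∈ R, π x := by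
    unfold wip; simp only [Pi.one_apply, mul_one]
    exact Finset.sum_coe_sort R (fun x => π x)
  rwa [e1, e2, e3, e4] at h

/-- heat-bath block matrix -/
noncomputable def heatBlock {Ω : Type*} [DecidableEq Ω] (π : Ω → ℝ) (R : Finset Ω) : Matrix Ω Ω ℝ :=
  Matrix.of fun x y => if x ∈ R ∧ y ∈ R then π y / ∑ z ∈ R, π z else 0

lemma heat_form {Ω : Type*} [Fintype Ω] [DecidableEq Ω] (π : Ω → ℝ) (R : Finset Ω) (g : Ω → ℝ) :
    wip π g ((heatBlock π R).mulVec g) = (∑ x ∈ R, π x * g x) ^ 2 / ∑ x ∈ R, π x := by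
  have h1 : ∀ x, (heatBlock π R).mulVec g x
      = if x ∈ R then (∑ y ∈ R, π y * g y) / ∑ z ∈ R, π z else 0 := by
    intro x
    simp only [Matrix.mulVec, dotProduct, heatBlock, Matrix.of_apply]
    by_cases hx : x ∈ R
    · simp only [hx, true_and, if_true, ite_mul, zero_mul]
      rw [Finset.sum_ite_mem, Finset.univ_inter, Finset.sum_div]
      exact Finset.sum_congr rfl fun y _ => by ring
    · simp [hx]
  unfold wip
  simp only [h1, mul_ite, mul_zero]
  rw [Finset.sum_ite_mem, Finset.univ_inter, ← Finset.sum_mul]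
  ring

lemma wip_mix {Ω : Type*} [Fintype Ω] {L : Type*} [Fintype L] (π : Ω → ℝ) (ρ : L → ℝ)
    (blocks : L → Finset (Finset Ω)) (Q : L → Finset Ω → Matrix Ω Ω ℝ) (f g : Ω → ℝ) :
    wip π f ((∑ a, ρ a • ∑ R ∈ blocks a, Q a R).mulVec g)
      = ∑ a, ρ a * ∑ R ∈ blocks a, wip π f ((Q a R).mulVec g) := by
  have hR : ∀ (s : Finset (Finset Ω)) (q : Finset Ω → Matrix Ω Ω ℝ),
      wip π f ((∑ R ∈ s, q R).mulVec g) = ∑ R ∈ s, wip π f ((q R).mulVec g) := by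
    intro s q
    simp only [Matrix.sum_mulVec, wip, Finset.sum_apply, Finset.mul_sum]
    rw [Finset.sum_comm]
  rw [Matrix.sum_mulVec]
  have : ∀ v : L → Ω → ℝ, wip π f (∑ a, v a) = ∑ a, wip π f (v a) := by
    intro v
    rw [wip_comm, wip_sum_left]
    exact Finset.sum_congr rfl fun a _ => wip_comm _ _ _
  rw [this]
  refine Finset.sum_congr rfl fun a _ => ?_
  rw [Matrix.smul_mulVec, wip_smul_right, hR]

lemma sum_part {Ω : Type*} [Fintype Ω] [DecidableEq Ω] (B : Finset (Finset Ω))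
    (hpart : ∀ x : Ω, ∃! R, R ∈ B ∧ x ∈ R) (F : Ω → ℝ) :
    ∑ R ∈ B, ∑ x ∈ R, F x = ∑ x, F x := by
  have h1 : ∀ R, ∑ x ∈ R, F x = ∑ x, if x ∈ R then F x else 0 := by
    intro R; rw [Finset.sum_ite_mem, Finset.univ_inter]
  rw [Finset.sum_congr rfl (fun R _ => h1 R), Finset.sum_comm]
  refine Finset.sum_congr rfl fun x _ => ?_
  obtain ⟨R0, ⟨hR0, hx0⟩, hu⟩ := hpart x
  rw [Finset.sum_eq_single R0 (fun R hR hne => if_neg fun hx => hne (hu R ⟨hR, hx⟩))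
    (fun h => absurd hR0 h), if_pos hx0]

lemma mix_rev {Ω : Type*} [Fintype Ω] [DecidableEq Ω] {L : Type*} [Fintype L]
    (π : Ω → ℝ) (ρ : L → ℝ)
    (blocks : L → Finset (Finset Ω)) (Q : L → Finset Ω → Matrix Ω Ω ℝ)
    (hrev : ∀ a, ∀ R ∈ blocks a, ∀ x y, π x * Q a R x y = π y * Q a R y x) (x y : Ω) :
    π x * (∑ a, ρ a • ∑ R ∈ blocks a, Q a R) x y = π y * (∑ a, ρ a • ∑ R ∈ blocks a, Q a R) y x := by
  simp only [Matrix.sum_apply, Matrix.smul_apply, smul_eq_mul, Finset.mul_sum]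
  refine Finset.sum_congr rfl fun a _ => Finset.sum_congr rfl fun R hR => ?_
  have := hrev a R hR x y
  linear_combination ρ a * this

lemma mix_one {Ω : Type*} [Fintype Ω] [DecidableEq Ω] {L : Type*} [Fintype L]
    (ρ : L → ℝ) (hρsum : ∑ a, ρ a = 1)
    (blocks : L → Finset (Finset Ω)) (hpart : ∀ a, ∀ x : Ω, ∃! R, R ∈ blocks a ∧ x ∈ R)
    (Q : L → Finset Ω → Matrix Ω Ω ℝ)
    (hsupp : ∀ a, ∀ R ∈ blocks a, ∀ x y, (x ∉ R ∨ y ∉ R) → Q a R x y = 0)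
    (hst : ∀ a, ∀ R ∈ blocks a, ∀ x ∈ R, ∑ y ∈ R, Q a R x y = 1) :
    (∑ a, ρ a • ∑ R ∈ blocks a, Q a R).mulVec 1 = 1 := by
  funext x
  simp only [Matrix.sum_mulVec, Matrix.smul_mulVec, Finset.sum_apply, Pi.smul_apply, smul_eq_mul,
    Pi.one_apply]
  rw [← hρsum]
  refine Finset.sum_congr rfl fun a _ => ?_
  obtain ⟨R0, ⟨hR0, hx0⟩, hu⟩ := hpart a x
  rw [Finset.sum_eq_single_of_mem R0 hR0 ?_]
  · simp only [Matrix.mulVec, dotProduct, Pi.one_apply, mul_one]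
    rw [← Finset.sum_subset (Finset.subset_univ R0)
      (fun z _ hz => hsupp a R0 hR0 x z (Or.inr hz)), hst a R0 hR0 x hx0, mul_one]
  · intro R hR hne
    simp only [Matrix.mulVec, dotProduct]
    exact Finset.sum_eq_zero fun y _ => by
      rw [hsupp a R hR x y (Or.inl fun hx => hne (hu R ⟨hR, hx⟩)), zero_mul]

lemma roots_nonneg {n : Type*} [Fintype n] [DecidableEq n] (w : n → ℝ) (hw : ∀ x, 0 < w x)
    (M : Matrix n n ℝ) (hrev : ∀ x y, w x * M x y = w y * M y x)
    (hpos : ∀ f, 0 ≤ wip w f (M.mulVec f)) : ∀ μ ∈ M.charpoly.roots, 0 ≤ μ := by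
  obtain ⟨l, e, hl, he, ho, hc⟩ := spectral_rev w hw M hrev
  intro μ hμ
  rw [hl] at hμ
  obtain ⟨i, -, rfl⟩ := Multiset.mem_map.mp hμ
  have := hpos (e i)
  rwa [he, wip_smul_right, ho, if_pos rfl, mul_one] at this

/-- heat-bath comparison: let `P = Σ_a ρ(a) Σ_{R ∈ R_a} P_R` be an
ergodic Markov chain built from a probability distribution `ρ` on a finite index set `L`,
partitions `R_a` of the finite state space `Ω` and, for each block `R`, an ergodic
time-reversible chain `P_R` on `R` (zero outside `R × R`) with stationary distribution
`π(x)/π(R)`; let `P_heat = Σ_a ρ(a) Σ_{R ∈ R_a} 1·σ_R` be its heat-bath variant.  If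
`α, β ≠ 0` with `αβ > 0` are such that every eigenvalue `μ ≠ 1` of every restricted block
chain satisfies `μ ≥ 0` and `α - β(1 - μ) ≥ 0`, then
`(1/α)(1 - λ_*^heat)⁻¹ ≤ (1/β)(1 - λ_*)⁻¹` for the second-largest eigenvalues
(enumerated antitonely by `lam`, `lamH`); moreover `P` and `P_heat` have only
non-negative eigenvalues, and in particular `(1 - λ_*^heat)⁻¹ ≤ (1 - λ_*)⁻¹`. -/
theorem stmt_0 {Ω : Type*} [Fintype Ω] [DecidableEq Ω] (hcard : 2 ≤ Fintype.card Ω)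
    {L : Type*} [Fintype L]
    (π : Ω → ℝ) (hπpos : ∀ x, 0 < π x) (hπsum : ∑ x, π x = 1)
    (ρ : L → ℝ) (hρnn : ∀ a, 0 ≤ ρ a) (hρsum : ∑ a, ρ a = 1)
    (blocks : L → Finset (Finset Ω))
    (hpart : ∀ a, ∀ x : Ω, ∃! R, R ∈ blocks a ∧ x ∈ R)
    (PR : L → Finset Ω → Matrix Ω Ω ℝ)
    (hsupp : ∀ a, ∀ R ∈ blocks a, ∀ x y, (x ∉ R ∨ y ∉ R) → PR a R x y = 0)
    (hnn : ∀ a, ∀ R ∈ blocks a, ∀ x y, 0 ≤ PR a R x y)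
    (hstoch : ∀ a, ∀ R ∈ blocks a, ∀ x ∈ R, ∑ y ∈ R, PR a R x y = 1)
    (hrev : ∀ a, ∀ R ∈ blocks a, ∀ x y, π x * PR a R x y = π y * PR a R y x)
    (hergR : ∀ a, ∀ R ∈ blocks a,
      ∃ T : ℕ, ∀ t ≥ T, ∀ x ∈ R, ∀ y ∈ R, 0 < ((PR a R) ^ t) x y)
    (P Pheat : Matrix Ω Ω ℝ)
    (hP : P = ∑ a, ρ a • ∑ R ∈ blocks a, PR a R)
    (hPheat : Pheat = ∑ a, ρ a • ∑ R ∈ blocks a,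
        Matrix.of fun x y => if x ∈ R ∧ y ∈ R then π y / ∑ z ∈ R, π z else 0)
    (hPerg : ∃ T : ℕ, ∀ t ≥ T, ∀ x y, 0 < (P ^ t) x y)
    (α β : ℝ) (hα : α ≠ 0) (hβ : β ≠ 0) (hαβ : 0 < α * β)
    (hblock : ∀ a, ∀ R ∈ blocks a, ∀ μ ∈ (restrictTo R (PR a R)).charpoly.roots,
      μ ≠ 1 → 0 ≤ μ ∧ 0 ≤ α - β * (1 - μ))
    (lam lamH : ℕ → ℝ)
    (hanti : Antitone lam) (hlam0 : lam 0 = 1)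
    (hroots : P.charpoly.roots = (Multiset.range (Fintype.card Ω)).map lam)
    (hantiH : Antitone lamH) (hlamH0 : lamH 0 = 1)
    (hrootsH : Pheat.charpoly.roots = (Multiset.range (Fintype.card Ω)).map lamH) :
    (1 / α) * (1 - lamH 1)⁻¹ ≤ (1 / β) * (1 - lam 1)⁻¹ ∧
    (∀ μ ∈ P.charpoly.roots, 0 ≤ μ) ∧
    (∀ μ ∈ Pheat.charpoly.roots, 0 ≤ μ) ∧
    (1 - lamH 1)⁻¹ ≤ (1 - lam 1)⁻¹ := by
  have hheat : Pheat = ∑ a, ρ a • ∑ R ∈ blocks a, heatBlock π R := hPheat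
  have hsumpos : ∀ (R : Finset Ω) (x : Ω), x ∈ R → 0 < ∑ z ∈ R, π z := fun R x hx =>
    Finset.sum_pos (fun z _ => hπpos z) ⟨x, hx⟩
  have hPrev : ∀ x y, π x * P x y = π y * P y x := by
    intro x y; rw [hP]; exact mix_rev π ρ blocks PR hrev x y
  have hP1 : P.mulVec 1 = 1 := by
    rw [hP]; exact mix_one ρ hρsum blocks hpart PR hsupp hstoch
  have hHrev : ∀ x y, π x * Pheat x y = π y * Pheat y x := by
    intro x y; rw [hheat]
    refine mix_rev π ρ blocks (fun _ R => heatBlock π R) (fun a R _ x y => ?_) x y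
    simp only [heatBlock, Matrix.of_apply]
    by_cases h : x ∈ R ∧ y ∈ R
    · rw [if_pos h, if_pos h.symm]; ring
    · rw [if_neg h, if_neg (fun h' => h h'.symm)]; ring
  have hH1 : Pheat.mulVec 1 = 1 := by
    rw [hheat]
    refine mix_one ρ hρsum blocks hpart (fun _ R => heatBlock π R) (fun a R _ x y h => ?_)
      (fun a R _ x hx => ?_)
    · simp only [heatBlock, Matrix.of_apply]
      exact if_neg (by tauto)
    · simp only [heatBlock, Matrix.of_apply]
      rw [Finset.sum_congr rfl (fun y hy => if_pos ⟨hx, hy⟩), ← Finset.sum_div]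
      exact div_self (hsumpos R x hx).ne'
  have hnorm : ∀ f, wip π f f = ∑ a, ρ a * ∑ R ∈ blocks a, ∑ x ∈ R, π x * f x * f x := by
    intro f
    simp only [sum_part _ (hpart _)]
    rw [← Finset.sum_mul, hρsum, one_mul]; rfl
  have hcmp : ∀ a b : ℝ, (∀ l, ∀ R ∈ blocks l, ∀ μ ∈ (restrictTo R (PR l R)).charpoly.roots,
      μ ≠ 1 → 0 ≤ a - b * (1 - μ)) → ∀ f,
      b * (wip π f f - wip π f (P.mulVec f)) ≤ a * (wip π f f - wip π f (Pheat.mulVec f)) := by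
    intro a b hab f
    rw [hnorm, hP, hheat, wip_mix, wip_mix π ρ blocks (fun _ R => heatBlock π R),
      ← Finset.sum_sub_distrib, ← Finset.sum_sub_distrib, Finset.mul_sum, Finset.mul_sum]
    refine Finset.sum_le_sum fun l _ => ?_
    rw [← mul_sub, ← mul_sub, ← Finset.sum_sub_distrib, ← Finset.sum_sub_distrib,
      mul_left_comm b, mul_left_comm a]
    refine mul_le_mul_of_nonneg_left ?_ (hρnn l)
    rw [Finset.mul_sum, Finset.mul_sum]
    refine Finset.sum_le_sum fun R hR => ?_
    rw [heat_form]
    exact block_omega π hπpos R (PR l R) (hsupp l R hR) (hstoch l R hR) (hrev l R hR)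
      (hergR l R hR) a b (hab l R hR) f
  have hcmp1 := hcmp 1 1 (fun l R hR μ hμ h1 => by
    have := (hblock l R hR μ hμ h1).1; linarith)
  have hcmpab := hcmp α β (fun l R hR μ hμ h1 => (hblock l R hR μ hμ h1).2)
  have hHnn : ∀ f, 0 ≤ wip π f (Pheat.mulVec f) := by
    intro f
    rw [hheat, wip_mix π ρ blocks (fun _ R => heatBlock π R)]
    refine Finset.sum_nonneg fun a _ => mul_nonneg (hρnn a) (Finset.sum_nonneg fun R _ => ?_)
    rw [heat_form]
    exact div_nonneg (sq_nonneg _) (Finset.sum_nonneg fun z _ => (hπpos z).le)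
  have hPnn : ∀ f, 0 ≤ wip π f (P.mulVec f) := by
    intro f
    have := hcmp1 f; have := hHnn f; linarith
  have hlt : lam 1 < 1 := by
    have hle : lam 1 ≤ 1 := hlam0 ▸ hanti (by omega)
    refine lt_of_le_of_ne hle fun h => ?_
    obtain ⟨-, f, hf, hf1, -, hfix⟩ :=
      second_eig hcard π hπpos P hPrev hP1 lam hanti hlam0 hroots
    obtain ⟨T, hT⟩ := hPerg
    obtain ⟨c, hc⟩ := fixed_const univ P ⟨T, fun t ht x _ y _ => hT t ht x y⟩
      (fun x y h => by simp at h) (fun x _ => by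
        have := congrFun hP1 x
        simpa [Matrix.mulVec, dotProduct] using this) f (fun x h => by simp at h) (hfix h)
    have hc0 : c = 0 := by
      unfold wip at hf1
      rw [Finset.sum_congr rfl (fun x hx => by rw [hc x hx, Pi.one_apply, mul_one]),
        ← Finset.sum_mul, hπsum, one_mul] at hf1
      exact hf1
    apply hf
    funext x
    rw [hc x (mem_univ x), hc0]; rfl
  have g1 := gap_compare hcard π hπpos P Pheat hPrev hP1 hHrev hH1 lam lamH hanti hlam0 hroots
    hantiH hlamH0 hrootsH 1 1 one_pos one_pos hcmp1
  have p1 : 0 < 1 - lam 1 := by linarith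
  have p2 : 0 < 1 - lamH 1 := by linarith
  refine ⟨?_, roots_nonneg π hπpos P hPrev hPnn, roots_nonneg π hπpos Pheat hHrev hHnn,
    inv_anti₀ p1 (by linarith)⟩
  rcases lt_or_gt_of_ne hβ with hb | hb
  · have ha : α < 0 := by nlinarith
    have g2 := gap_compare hcard π hπpos Pheat P hHrev hH1 hPrev hP1 lamH lam hantiH hlamH0 hrootsH
      hanti hlam0 hroots (-β) (-α) (by linarith) (by linarith)
      (fun f => by have := hcmpab f; linarith)
    have h3 := inv_anti₀ (mul_pos (neg_pos.mpr ha) p2) g2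
    rw [mul_inv, mul_inv, inv_neg, inv_neg] at h3
    rw [one_div, one_div]
    linarith
  · have ha : 0 < α := by nlinarith
    have g2 := gap_compare hcard π hπpos P Pheat hPrev hP1 hHrev hH1 lam lamH hanti hlam0 hroots
      hantiH hlamH0 hrootsH α β ha hb hcmpab
    have h3 := inv_anti₀ (mul_pos hb p1) g2
    rw [mul_inv, mul_inv] at h3
    rw [one_div, one_div]
    exact h3
end

section
/- Let n ≥ 3, let r_max = max_i r_i be the maximum row sum, and assume the KTV-switch chain on Ω = Ω(r,c,F) is irreducible. Then, with λ_*^{KTV} and λ_*^c the second-largest eigenvalues of P_KTV and P_c respectively, the relaxation times satisfy (2/(n(n−1)))·(1 − λ_*^{KTV})^{-1} ≤ (1 − λ_*^c)^{-1} ≤ min{1, (2r_max + 1)²/(2n(n−1))}·(1 − λ_*^{KTV})^{-1}. -/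
open Finset

attribute [local instance] Classical.propDecidable

/-- A binary `m × n` matrix, with `true` representing a `1` entry. -/
abbrev BinMat (m n : ℕ) := Fin m → Fin n → Bool

/-- `A ∈ Ω(r,c,F)`: the binary matrix `A` has row sums `r`, column sums `c`, and is zero
on the forbidden entries `F`. -/
def inOmega {m n : ℕ} (r : Fin m → ℕ) (c : Fin n → ℕ) (F : Finset (Fin m × Fin n))
    (A : BinMat m n) : Prop :=
  (∀ i : Fin m, (univ.filter fun k => A i k = true).card = r i) ∧
  (∀ k : Fin n, (univ.filter fun i => A i k = true).card = c k) ∧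
  ∀ p ∈ F, A p.1 p.2 = false

/-- `U_ij(A)`: columns with a `1` in row `i`, a `0` in row `j`, and `(j,k)` not forbidden. -/
def Uset {m n : ℕ} (F : Finset (Fin m × Fin n)) (i j : Fin m) (A : BinMat m n) :
    Finset (Fin n) :=
  univ.filter fun k => A i k = true ∧ A j k = false ∧ (j, k) ∉ F

/-- `L_ij(A)`: columns with a `0` in row `i`, a `1` in row `j`, and `(i,k)` not forbidden. -/
def Lset {m n : ℕ} (F : Finset (Fin m × Fin n)) (i j : Fin m) (A : BinMat m n) :
    Finset (Fin n) :=
  univ.filter fun k => A i k = false ∧ A j k = true ∧ (i, k) ∉ F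

/-- `u_ij(A) = |U_ij(A)|`. -/
def usize {m n : ℕ} (F : Finset (Fin m × Fin n)) (i j : Fin m) (A : BinMat m n) : ℕ :=
  (Uset F i j A).card

/-- `l_ij(A) = |L_ij(A)|`. -/
def lsize {m n : ℕ} (F : Finset (Fin m × Fin n)) (i j : Fin m) (A : BinMat m n) : ℕ :=
  (Lset F i j A).card

/-- `B ∈ N_ij(A)`: `B ∈ Ω` and `B` agrees with `A` outside `{i,j} × (U_ij(A) ∪ L_ij(A))`. -/
def inNbhd {m n : ℕ} (r : Fin m → ℕ) (c : Fin n → ℕ) (F : Finset (Fin m × Fin n))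
    (i j : Fin m) (A B : BinMat m n) : Prop :=
  inOmega r c F B ∧
  ∀ k l, (k, l) ∉ (({i, j} : Finset (Fin m)) ×ˢ (Uset F i j A ∪ Lset F i j A)) →
    B k l = A k l

/-- `A` and `B` are switch-adjacent for rows `i, j`: `A - B` has exactly four nonzero
entries, all in rows `i` and `j`, and the columns containing them have no forbidden
entries in rows `i` and `j`. -/
def switchAdjIJ {m n : ℕ} (F : Finset (Fin m × Fin n)) (i j : Fin m)
    (A B : BinMat m n) : Prop :=
  ((univ : Finset (Fin m × Fin n)).filter fun p => A p.1 p.2 ≠ B p.1 p.2).card = 4 ∧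
  (∀ p ∈ (univ : Finset (Fin m × Fin n)).filter fun p => A p.1 p.2 ≠ B p.1 p.2,
    p.1 = i ∨ p.1 = j) ∧
  ∀ p ∈ (univ : Finset (Fin m × Fin n)).filter fun p => A p.1 p.2 ≠ B p.1 p.2,
    (i, p.2) ∉ F ∧ (j, p.2) ∉ F

/-- The pairs of rows `i < j`. -/
def rowPairs (m : ℕ) : Finset (Fin m × Fin m) :=
  univ.filter fun p => p.1 < p.2

/-- The state space `Ω(r,c,F)` as a type. -/
abbrev OmegaType {m n : ℕ} (r : Fin m → ℕ) (c : Fin n → ℕ) (F : Finset (Fin m × Fin n)) :=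
  {A : BinMat m n // inOmega r c F A}

/-- Transition matrix of the KTV-switch chain on `Ω(r,c,F)` (the `γ`-switch chain with
`γ = 2/(n(n-1))`). -/
noncomputable def PKTV {m n : ℕ} (r : Fin m → ℕ) (c : Fin n → ℕ)
    (F : Finset (Fin m × Fin n)) :
    Matrix (OmegaType r c F) (OmegaType r c F) ℝ :=
  Matrix.of fun A B =>
    if A = B then
      (m.choose 2 : ℝ)⁻¹ *
        ∑ p ∈ rowPairs m,
          (1 - (usize F p.1 p.2 A.val : ℝ) * (lsize F p.1 p.2 A.val : ℝ) *
            (2 / ((n : ℝ) * ((n : ℝ) - 1))))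
    else if ∃ p ∈ rowPairs m, switchAdjIJ F p.1 p.2 A.val B.val then
      (m.choose 2 : ℝ)⁻¹ * (2 / ((n : ℝ) * ((n : ℝ) - 1)))
    else 0

/-- Transition matrix of the Curveball chain on `Ω(r,c,F)`.  (For `A ≠ B` at most one
row pair `p` satisfies `B ∈ N_p(A)`, so the sum below has at most one nonzero term.) -/
noncomputable def Pcurve {m n : ℕ} (r : Fin m → ℕ) (c : Fin n → ℕ)
    (F : Finset (Fin m × Fin n)) :
    Matrix (OmegaType r c F) (OmegaType r c F) ℝ :=
  Matrix.of fun A B =>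
    if A = B then
      (m.choose 2 : ℝ)⁻¹ *
        ∑ p ∈ rowPairs m,
          (((usize F p.1 p.2 A.val + lsize F p.1 p.2 A.val).choose
            (usize F p.1 p.2 A.val) : ℝ))⁻¹
    else
      ∑ p ∈ rowPairs m,
        if inNbhd r c F p.1 p.2 A.val B.val then
          (m.choose 2 : ℝ)⁻¹ *
            (((usize F p.1 p.2 A.val + lsize F p.1 p.2 A.val).choose
              (usize F p.1 p.2 A.val) : ℝ))⁻¹
        else 0

section Johnson
variable {α : Type*} [DecidableEq α]

lemma jdc (V : Finset α) (u : ℕ) (h : Finset α → α → ℝ) :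
    ∑ R ∈ powersetCard u V, ∑ y ∈ V \ R, h R y =
      ∑ S ∈ powersetCard (u+1) V, ∑ y ∈ S, h (S.erase y) y := by
  rw [Finset.sum_sigma', Finset.sum_sigma']
  refine Finset.sum_bij' (fun a _ => ⟨insert a.2 a.1, a.2⟩) (fun a _ => ⟨a.1.erase a.2, a.2⟩) ?_ ?_ ?_ ?_ ?_
  · rintro ⟨R, y⟩ h
    simp only [mem_sigma, mem_powersetCard, mem_sdiff] at h ⊢
    obtain ⟨⟨h1, h2⟩, h3, h4⟩ := h
    refine ⟨⟨?_, ?_⟩, mem_insert_self _ _⟩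
    · exact insert_subset h3 h1
    · rw [card_insert_of_notMem h4, h2]
  · rintro ⟨R, y⟩ h
    simp only [mem_sigma, mem_powersetCard, mem_sdiff] at h ⊢
    obtain ⟨⟨h1, h2⟩, h3⟩ := h
    refine ⟨⟨(erase_subset _ _).trans h1, ?_⟩, h1 h3, notMem_erase _ _⟩
    rw [card_erase_of_mem h3, h2]; rfl
  · rintro ⟨R, y⟩ h
    simp only [mem_sigma, mem_powersetCard, mem_sdiff] at h ⊢
    simp [erase_insert h.2.2]
  · rintro ⟨R, y⟩ h
    simp only [mem_sigma, mem_powersetCard, mem_sdiff] at h ⊢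
    simp [insert_erase h.2]
  · rintro ⟨R, y⟩ h
    simp only [mem_sigma, mem_powersetCard, mem_sdiff] at h ⊢
    simp [erase_insert h.2.2]

noncomputable def EJ (V : Finset α) (u : ℕ) (f : Finset α → ℝ) : ℝ :=
  ∑ S ∈ powersetCard u V, ∑ x ∈ S, ∑ y ∈ V \ S, (f S - f (insert y (S.erase x)))^2

lemma sum_pc_insert {z : α} {W : Finset α} (hz : z ∉ W) (u : ℕ) (G : Finset α → ℝ) :
    ∑ S ∈ powersetCard (u+1) (insert z W), G S =
      ∑ S ∈ powersetCard (u+1) W, G S + ∑ R ∈ powersetCard u W, G (insert z R) := by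
  rw [powersetCard_succ_insert hz, sum_union, sum_image]
  · intro a ha b hb hab
    simp only [mem_coe, mem_powersetCard] at ha hb
    have h1 : z ∉ a := fun h => hz (ha.1 h)
    have h2 : z ∉ b := fun h => hz (hb.1 h)
    rw [← erase_insert h1, ← erase_insert h2, hab]
  · rw [disjoint_left]
    intro a ha hb
    simp only [mem_powersetCard, mem_image] at ha hb
    obtain ⟨b, _, rfl⟩ := hb
    exact hz (ha.1 (mem_insert_self _ _))

lemma EJ_insert {z : α} {W : Finset α} (hz : z ∉ W) (u : ℕ) (f : Finset α → ℝ) :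
    EJ (insert z W) (u+1) f = EJ W (u+1) f + EJ W u (fun R => f (insert z R))
      + 2 * ∑ R ∈ powersetCard u W, ∑ y ∈ W \ R, (f (insert z R) - f (insert y R))^2 := by
  unfold EJ
  rw [sum_pc_insert hz]
  have e1 : ∀ S ∈ powersetCard (u+1) W, ∑ x ∈ S, ∑ y ∈ insert z W \ S, (f S - f (insert y (S.erase x)))^2
      = ∑ x ∈ S, ∑ y ∈ W \ S, (f S - f (insert y (S.erase x)))^2
        + ∑ x ∈ S, (f (insert z (S.erase x)) - f (insert x (S.erase x)))^2 := by
    intro S hS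
    rw [mem_powersetCard] at hS
    have hzS : z ∉ S := fun h => hz (hS.1 h)
    rw [insert_sdiff_of_notMem _ hzS, ← sum_add_distrib]
    refine sum_congr rfl fun x hx => ?_
    rw [sum_insert (by simp [hz]), insert_erase hx]
    ring
  have e2 : ∀ R ∈ powersetCard u W, ∑ x ∈ insert z R, ∑ y ∈ insert z W \ insert z R,
        (f (insert z R) - f (insert y ((insert z R).erase x)))^2
      = ∑ x ∈ R, ∑ y ∈ W \ R, (f (insert z R) - f (insert z (insert y (R.erase x))))^2
        + ∑ y ∈ W \ R, (f (insert z R) - f (insert y R))^2 := by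
    intro R hR
    rw [mem_powersetCard] at hR
    have hzR : z ∉ R := fun h => hz (hR.1 h)
    have hs : insert z W \ insert z R = W \ R := by
      ext a; simp only [mem_sdiff, mem_insert]
      constructor
      · rintro ⟨h1, h2⟩; tauto
      · rintro ⟨h1, h2⟩
        refine ⟨Or.inr h1, ?_⟩
        rintro (rfl | h)
        · exact hz h1
        · exact h2 h
    rw [hs, sum_insert hzR, erase_insert hzR, add_comm]
    congr 1
    refine sum_congr rfl fun x hx => sum_congr rfl fun y hy => ?_
    have hxz : z ≠ x := by rintro rfl; exact hzR hx
    rw [erase_insert_of_ne hxz, Finset.insert_comm]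
  rw [sum_congr rfl e1, sum_congr rfl e2, sum_add_distrib, sum_add_distrib,
    ← jdc W u (fun R x => (f (insert z R) - f (insert x R))^2)]
  ring

lemma EJ_nonneg (V : Finset α) (u : ℕ) (f : Finset α → ℝ) : 0 ≤ EJ V u f := by
  unfold EJ; positivity

lemma johnson_poincare (V : Finset α) : ∀ (u : ℕ) (f : Finset α → ℝ),
    ∑ S ∈ powersetCard u V, f S ^ 2 - (∑ S ∈ powersetCard u V, f S)^2 / (V.card.choose u : ℝ)
      ≤ EJ V u f / 2 := by
  induction V using Finset.induction_on with
  | empty =>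
    intro u f
    rcases u with _ | u
    · simp [EJ]
    · have hp : powersetCard (u+1) (∅ : Finset α) = ∅ := powersetCard_eq_empty.2 (by simp)
      simp [EJ, hp]
  | insert z W hz ih =>
    intro u f
    rcases u with _ | u
    · simp [EJ]
    · rw [sum_pc_insert hz, sum_pc_insert hz, EJ_insert hz, card_insert_of_notMem hz, Nat.choose_succ_succ]
      have h0 := ih (u+1) f
      have h1 := ih u (fun R => f (insert z R))
      have hX : (∑ R ∈ powersetCard u W, ∑ y ∈ W \ R, (f (insert z R) - f (insert y R)))^2 ≤
          ((W.card.choose u : ℝ) * ((W.card - u : ℕ) : ℝ)) *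
          ∑ R ∈ powersetCard u W, ∑ y ∈ W \ R, (f (insert z R) - f (insert y R))^2 := by
        have hc : ∑ R ∈ powersetCard u W, (W \ R).card = W.card.choose u * (W.card - u) := by
          rw [← card_powersetCard, ← smul_eq_mul, ← sum_const]
          refine sum_congr rfl fun R hR => ?_
          rw [mem_powersetCard] at hR
          rw [card_sdiff_of_subset hR.1, hR.2]
        rw [Finset.sum_sigma', Finset.sum_sigma']
        refine sq_sum_le_card_mul_sum_sq.trans_eq ?_
        rw [card_sigma, hc]; push_cast; rfl
      have hS : ∑ R ∈ powersetCard u W, ∑ y ∈ W \ R, (f (insert z R) - f (insert y R)) =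
          ((W.card - u : ℕ) : ℝ) * ∑ R ∈ powersetCard u W, f (insert z R)
          - ((u : ℝ) + 1) * ∑ S ∈ powersetCard (u+1) W, f S := by
        simp only [sum_sub_distrib]
        rw [jdc W u (fun R y => f (insert y R)), mul_sum, mul_sum]
        congr 1
        · refine sum_congr rfl fun R hR => ?_
          rw [mem_powersetCard] at hR
          rw [sum_const, card_sdiff_of_subset hR.1, hR.2, nsmul_eq_mul]
        · refine sum_congr rfl fun S hS => ?_
          rw [mem_powersetCard] at hS
          rw [sum_congr rfl (g := fun _ => f S) (fun x hx => by rw [insert_erase hx]), sum_const, hS.2, nsmul_eq_mul]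
          push_cast; rfl
      rw [hS] at hX
      have hX0 : 0 ≤ ∑ R ∈ powersetCard u W, ∑ y ∈ W \ R, (f (insert z R) - f (insert y R))^2 := by positivity
      have hE0 := EJ_nonneg W (u+1) f
      have hE1 := EJ_nonneg W u (fun R => f (insert z R))
      by_cases hw : u < W.card
      · have hN0 : (0:ℝ) < W.card.choose (u+1) := by exact_mod_cast Nat.choose_pos hw
        have hN1 : (0:ℝ) < W.card.choose u := by exact_mod_cast Nat.choose_pos hw.le
        have hl : (1:ℝ) ≤ ((W.card - u : ℕ) : ℝ) := by exact_mod_cast (by omega)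
        have hK : (W.card.choose (u+1) : ℝ) * ((u:ℝ)+1) = W.card.choose u * ((W.card - u : ℕ) : ℝ) := by
          exact_mod_cast Nat.choose_succ_right_eq W.card u
        push_cast
        generalize (W.card.choose (u+1) : ℝ) = N0 at *
        generalize (W.card.choose u : ℝ) = N1 at *
        generalize ((W.card - u : ℕ) : ℝ) = l at *
        generalize ((u:ℝ)+1) = v at *
        generalize (∑ R ∈ powersetCard u W, ∑ y ∈ W \ R, (f (insert z R) - f (insert y R))^2) = X at *
        generalize (∑ S ∈ powersetCard (u+1) W, f S) = a0 at *
        generalize (∑ R ∈ powersetCard u W, f (insert z R)) = a1 at *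
        obtain ⟨m0, rfl⟩ : ∃ m, a0 = N0 * m := ⟨a0 / N0, by field_simp⟩
        obtain ⟨m1, rfl⟩ : ∃ m, a1 = N1 * m := ⟨a1 / N1, by field_simp⟩
        have e0 : (N0 * m0)^2 / N0 = N0 * m0^2 := by field_simp
        have e1 : (N1 * m1)^2 / N1 = N1 * m1^2 := by field_simp
        rw [e0] at h0
        rw [e1] at h1
        have h3 : l * (N1 * m1) - v * (N0 * m0) = N1 * l * (m1 - m0) := by
          linear_combination (-m0) * hK
        rw [h3] at hX
        have hKp : 0 < N1 * l := by positivity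
        have h4 : N1 * l * (m1 - m0)^2 ≤ X := by
          have : (N1 * l) * (N1 * l * (m1 - m0)^2) ≤ (N1 * l) * X := by nlinarith
          exact le_of_mul_le_mul_left this hKp
        have h5 : N1 * (m1-m0)^2 ≤ X := by
          refine le_trans ?_ h4
          have : 0 ≤ N1 * (m1-m0)^2 := by positivity
          nlinarith
        have h6 : N0 * N1 / (N0+N1) * (m1-m0)^2 ≤ X := by
          refine le_trans ?_ h5
          have : N0 * N1 / (N0+N1) ≤ N1 := by
            rw [div_le_iff₀ (by positivity)]; nlinarith
          exact mul_le_mul_of_nonneg_right this (sq_nonneg _)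
        have h7 : (N0 * m0 + N1 * m1)^2/(N1 + N0) = N0 * m0^2 + N1 * m1^2 - N0 * N1 / (N0+N1) * (m1-m0)^2 := by
          have : N1 + N0 ≠ 0 := by positivity
          have : N0 + N1 ≠ 0 := by positivity
          field_simp; ring
        rw [h7]
        linarith
      · have hN0 : W.card.choose (u+1) = 0 := Nat.choose_eq_zero_of_lt (by omega)
        have hp : powersetCard (u+1) W = ∅ := powersetCard_eq_empty.2 (by omega)
        rw [hN0, hp]
        simp only [sum_empty, zero_add, add_zero]
        linarith

lemma sum_sum_sq_sub_le {β : Type*} (s : Finset β) (a : β → ℝ) :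
    ∑ x ∈ s, ∑ y ∈ s, (a x - a y)^2 ≤ 2 * s.card * ∑ x ∈ s, a x ^2 := by
  have : ∑ x ∈ s, ∑ y ∈ s, (a x - a y)^2 = 2 * s.card * ∑ x ∈ s, a x ^2 - 2 * (∑ x ∈ s, a x)^2 := by
    have e : ∀ x y, (a x - a y)^2 = a x ^2 + a y^2 - 2 * (a x * a y) := by intros; ring
    simp only [e, sum_sub_distrib, sum_add_distrib, sum_const, nsmul_eq_mul, ← mul_sum]
    rw [← sum_mul]
    ring
  rw [this]
  nlinarith [sq_nonneg (∑ x ∈ s, a x)]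

lemma EJ_le1 (V : Finset α) (u l : ℕ) (hul : u + l = V.card) (f : Finset α → ℝ) :
    EJ V u f ≤ 2 * (u * (l+1)) * ∑ S ∈ powersetCard u V, f S ^ 2 := by
  rcases u with _ | u
  · simp [EJ]
  have e : EJ V (u+1) f = ∑ S ∈ powersetCard (u+1) V, ∑ x ∈ S,
      (fun R x => ∑ y ∈ V \ insert x R, (f (insert x R) - f (insert y R))^2) (S.erase x) x := by
    unfold EJ
    refine sum_congr rfl fun S hS => sum_congr rfl fun x hx => ?_
    simp only [insert_erase hx]
  rw [e, ← jdc V u (fun R x => ∑ y ∈ V \ insert x R, (f (insert x R) - f (insert y R))^2)]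
  calc _ ≤ ∑ R ∈ powersetCard u V, 2 * ((l:ℝ)+1) * ∑ x ∈ V \ R, f (insert x R)^2 := by
        refine sum_le_sum fun R hR => ?_
        rw [mem_powersetCard] at hR
        have hc : ((V \ R).card : ℝ) = l + 1 := by
          rw [card_sdiff_of_subset hR.1, hR.2]
          have : V.card - u = l + 1 := by omega
          rw [this]; push_cast; rfl
        rw [← hc]
        refine le_trans ?_ (sum_sum_sq_sub_le (V \ R) (fun x => f (insert x R)))
        refine sum_le_sum fun x hx => ?_
        refine sum_le_sum_of_subset_of_nonneg ?_ (fun _ _ _ => sq_nonneg _)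
        exact sdiff_subset_sdiff (Subset.refl _) (subset_insert _ _)
    _ = _ := by
        rw [← mul_sum, jdc V u (fun R x => f (insert x R)^2)]
        have : ∑ S ∈ powersetCard (u+1) V, ∑ x ∈ S, f (insert x (S.erase x))^2
            = ((u:ℝ)+1) * ∑ S ∈ powersetCard (u+1) V, f S ^2 := by
          rw [mul_sum]
          refine sum_congr rfl fun S hS => ?_
          rw [mem_powersetCard] at hS
          rw [sum_congr rfl (g := fun _ => f S^2) (fun x hx => by rw [insert_erase hx]), sum_const, hS.2, nsmul_eq_mul]
          push_cast; rfl
        rw [this]; push_cast; ring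

lemma EJ_le2 (V : Finset α) (u l : ℕ) (hul : u + l = V.card) (f : Finset α → ℝ) :
    EJ V u f ≤ 2 * (l * (u+1)) * ∑ S ∈ powersetCard u V, f S ^ 2 := by
  have e : EJ V u f = ∑ S ∈ powersetCard u V, ∑ y ∈ V \ S,
      (fun S y => ∑ x ∈ S, (f S - f ((insert y S).erase x))^2) S y := by
    unfold EJ
    refine sum_congr rfl fun S hS => ?_
    rw [sum_comm]
    refine sum_congr rfl fun y hy => sum_congr rfl fun x hx => ?_
    rw [mem_sdiff] at hy
    have : y ≠ x := by rintro rfl; exact hy.2 hx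
    rw [erase_insert_of_ne this]
  rw [e, jdc]
  calc _ ≤ ∑ R ∈ powersetCard (u+1) V, 2 * ((u:ℝ)+1) * ∑ y ∈ R, f (R.erase y)^2 := by
        refine sum_le_sum fun R hR => ?_
        rw [mem_powersetCard] at hR
        have hc : (R.card : ℝ) = u + 1 := by rw [hR.2]; push_cast; rfl
        rw [← hc]
        refine le_trans ?_ (sum_sum_sq_sub_le R (fun x => f (R.erase x)))
        refine sum_le_sum fun x hx => ?_
        simp only [insert_erase hx]
        exact sum_le_sum_of_subset_of_nonneg (erase_subset _ _) (fun _ _ _ => sq_nonneg _)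
    _ = _ := by
        rw [← mul_sum, ← jdc V u (fun R x => f R^2)]
        have : ∑ S ∈ powersetCard u V, ∑ x ∈ V \ S, f S^2
            = (l:ℝ) * ∑ S ∈ powersetCard u V, f S ^2 := by
          rw [mul_sum]
          refine sum_congr rfl fun S hS => ?_
          rw [mem_powersetCard] at hS
          rw [sum_const, card_sdiff_of_subset hS.1, hS.2, nsmul_eq_mul]
          congr 2; omega
        rw [this]; push_cast; ring

lemma EJ_shift (V : Finset α) (u : ℕ) (f : Finset α → ℝ) (a : ℝ) :
    EJ V u (fun S => f S - a) = EJ V u f := by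
  unfold EJ; simp

lemma EJ_le_var (V : Finset α) (u l : ℕ) (hul : u + l = V.card) (f : Finset α → ℝ) (κ : ℝ)
    (hκ : (u * (l+1) : ℝ) ≤ κ ∨ (l * (u+1) : ℝ) ≤ κ) :
    EJ V u f ≤ 2 * κ * (∑ S ∈ powersetCard u V, f S ^ 2 -
      (∑ S ∈ powersetCard u V, f S)^2 / (V.card.choose u : ℝ)) := by
  have hN : (0:ℝ) < V.card.choose u := by exact_mod_cast Nat.choose_pos (by omega)
  set a := (∑ S ∈ powersetCard u V, f S) / (V.card.choose u : ℝ) with ha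
  have hv : ∑ S ∈ powersetCard u V, (f S - a) ^ 2 = ∑ S ∈ powersetCard u V, f S ^ 2 -
      (∑ S ∈ powersetCard u V, f S)^2 / (V.card.choose u : ℝ) := by
    have e : ∀ S, (f S - a)^2 = f S ^2 - 2 * a * f S + a^2 := by intros; ring
    simp only [e, sum_add_distrib, sum_sub_distrib, ← mul_sum, sum_const, card_powersetCard, nsmul_eq_mul]
    rw [ha]; field_simp; ring
  rw [← hv, ← EJ_shift V u f a]
  have hnn : 0 ≤ ∑ S ∈ powersetCard u V, (f S - a) ^ 2 := by positivity
  rcases hκ with h | h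
  · refine (EJ_le1 V u l hul _).trans ?_
    gcongr
  · refine (EJ_le2 V u l hul _).trans ?_
    gcongr

lemma sum_symm_two (V : Finset α) (u : ℕ) (S : Finset α) (hS : S ∈ powersetCard u V) (h : Finset α → ℝ) :
    ∑ T ∈ powersetCard u V, (if (S \ T ∪ T \ S).card = 2 then h T else 0) =
      ∑ x ∈ S, ∑ y ∈ V \ S, h (insert y (S.erase x)) := by
  rw [← sum_filter, ← sum_product']
  rw [mem_powersetCard] at hS
  symm
  refine sum_bij (fun p _ => insert p.2 (S.erase p.1)) ?_ ?_ ?_ ?_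
  · rintro ⟨x, y⟩ hp
    simp only [mem_product, mem_sdiff] at hp
    obtain ⟨hx, hyV, hy⟩ := hp
    have hxy : x ≠ y := by rintro rfl; exact hy hx
    simp only [mem_filter, mem_powersetCard]
    refine ⟨⟨insert_subset hyV ((erase_subset _ _).trans hS.1), ?_⟩, ?_⟩
    · rw [card_insert_of_notMem (by simp [hy]), card_erase_of_mem hx, hS.2]
      have : 0 < S.card := card_pos.2 ⟨x, hx⟩
      omega
    · have : S \ insert y (S.erase x) ∪ insert y (S.erase x) \ S = {x, y} := by
        ext a
        simp only [mem_union, mem_sdiff, mem_insert, mem_erase, mem_singleton]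
        by_cases h1 : a = x
        · subst h1; simp [hx, hxy]
        · by_cases h2 : a = y
          · subst h2; simp [hy]
          · simp [h1, h2]
      rw [this, card_pair hxy]
  · rintro ⟨x, y⟩ hp ⟨x', y'⟩ hp' heq
    simp only [mem_product, mem_sdiff] at hp hp' heq
    obtain ⟨hx, hyV, hy⟩ := hp
    obtain ⟨hx', hyV', hy'⟩ := hp'
    have h1 : y ∈ insert y' (S.erase x') := heq ▸ mem_insert_self _ _
    have h2 : x ∉ insert y' (S.erase x') := by
      rw [← heq]; simp only [mem_insert, mem_erase]; rintro (rfl | h)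
      · exact hy hx
      · exact h.1 rfl
    simp only [mem_insert, mem_erase, not_or, not_and] at h1 h2
    have e1 : y = y' := by tauto
    have e2 : x = x' := by tauto
    rw [e1, e2]
  · intro T hT
    simp only [mem_filter, mem_powersetCard] at hT
    obtain ⟨⟨hTV, hTc⟩, h2⟩ := hT
    rw [card_union_of_disjoint (disjoint_sdiff_sdiff)] at h2
    have h3 : (S \ T).card = (T \ S).card := card_sdiff_comm (by rw [hS.2, hTc])
    obtain ⟨x, hx⟩ := card_eq_one.1 (show (S \ T).card = 1 by omega)
    obtain ⟨y, hy⟩ := card_eq_one.1 (show (T \ S).card = 1 by omega)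
    have hx' : ∀ a, (a ∈ S ∧ a ∉ T) ↔ a = x := fun a => by rw [← mem_sdiff, hx, mem_singleton]
    have hy' : ∀ a, (a ∈ T ∧ a ∉ S) ↔ a = y := fun a => by rw [← mem_sdiff, hy, mem_singleton]
    have hx0 := (hx' x).2 rfl
    have hy0 := (hy' y).2 rfl
    refine ⟨(x, y), ?_, ?_⟩
    · simp only [mem_product, mem_sdiff]
      exact ⟨hx0.1, hTV hy0.1, hy0.2⟩
    · ext a
      simp only [mem_insert, mem_erase]
      have := hx' a
      have := hy' a
      by_cases h1 : a = x
      · subst h1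
        have : a ≠ y := by rintro rfl; exact hy0.2 hx0.1
        simp [this, hx0.2]
      · by_cases h2 : a = y
        · subst h2; simp [hy0.1]
        · tauto
  · intros; rfl

end Johnson
section Gap
open Matrix

lemma lam_eq_eig {ι : Type*} [Fintype ι] [DecidableEq ι] (P : Matrix ι ι ℝ) (hP : P.IsHermitian)
    (lam : ℕ → ℝ) (hanti : Antitone lam)
    (hroots : P.charpoly.roots = (Multiset.range (Fintype.card ι)).map lam) (k : Fin (Fintype.card ι)) :
    hP.eigenvalues₀ k = lam k := by
  have h1 := hP.sort_roots_charpoly_eq_eigenvalues₀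
  rw [hroots] at h1
  have h2 : List.ofFn hP.eigenvalues₀ = List.ofFn (fun k : Fin (Fintype.card ι) => lam k) := by
    refine List.Perm.eq_of_pairwise' (r := (· ≥ ·)) ?_ ?_ ?_
    · rw [← List.sortedGE_iff_pairwise]
      exact (hP.eigenvalues₀_antitone).sortedGE_ofFn
    · rw [← List.sortedGE_iff_pairwise]
      apply Antitone.sortedGE_ofFn
      intro a b hab
      exact hanti hab
    · rw [← h1, ← Multiset.coe_eq_coe, Multiset.sort_eq, Multiset.map_map]
      rw [← Fin.univ_val_map]
      have : (Multiset.range (Fintype.card ι)) = Multiset.map (fun k : Fin (Fintype.card ι) => (k:ℕ)) univ.val := by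
        rw [Fin.univ_val_map, List.ofFn_eq_map]
        simp [Multiset.range]
      rw [this, Multiset.map_map]
      rfl
  exact congrFun (List.ofFn_injective h2) k

lemma gap_spec {ι : Type*} [Fintype ι] [DecidableEq ι] (P : Matrix ι ι ℝ) (hs : ∀ a b, P a b = P b a)
    (hcard : 2 ≤ Fintype.card ι)
    (hconst : ∀ f : ι → ℝ, P *ᵥ f = f → ∀ a b, f a = f b)
    (lam : ℕ → ℝ) (hanti : Antitone lam) (h0 : lam 0 = 1)
    (hroots : P.charpoly.roots = (Multiset.range (Fintype.card ι)).map lam) :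
    lam 1 < 1 ∧ (∃ f : ι → ℝ, 0 < f ⬝ᵥ f ∧ ∑ a, f a = 0 ∧ P *ᵥ f = lam 1 • f) ∧
      ∀ f : ι → ℝ, ∑ a, f a = 0 → f ⬝ᵥ (P *ᵥ f) ≤ lam 1 * (f ⬝ᵥ f) := by
  have hP : P.IsHermitian := by
    ext a b; simp [hs a b]
  have hT : Pᵀ = P := by ext a b; simp [hs a b]
  have hev := lam_eq_eig P hP lam hanti hroots
  set σ := (Fintype.equivOfCardEq (Fintype.card_fin (Fintype.card ι)) : Fin (Fintype.card ι) ≃ ι) with hσ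
  have hev' : ∀ i, hP.eigenvalues i = lam (σ.symm i) := fun i => hev (σ.symm i)
  let v : ι → ι → ℝ := fun i => ⇑(hP.eigenvectorBasis i)
  have hPv : ∀ i, P *ᵥ v i = lam (σ.symm i) • v i := by
    intro i; rw [← hev' i]; exact hP.mulVec_eigenvectorBasis i
  have hin : ∀ x y : EuclideanSpace ℝ ι, inner ℝ x y = (x : ι → ℝ) ⬝ᵥ (y : ι → ℝ) := by
    intro x y
    rw [PiLp.inner_apply]; simp [dotProduct, mul_comm]
  have horth : ∀ i j, v i ⬝ᵥ v j = if i = j then 1 else 0 := by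
    intro i j
    rw [← hin]
    exact (orthonormal_iff_ite.1 hP.eigenvectorBasis.orthonormal) i j
  have hpars : ∀ f g : ι → ℝ, f ⬝ᵥ g = ∑ i, (f ⬝ᵥ v i) * (v i ⬝ᵥ g) := by
    intro f g
    have := hP.eigenvectorBasis.sum_inner_mul_inner (WithLp.toLp 2 f) (WithLp.toLp 2 g)
    simp only [hin] at this
    exact this.symm
  set i0 : ι := σ ⟨0, by omega⟩ with hi0
  set i1 : ι := σ ⟨1, by omega⟩ with hi1
  have hs0 : σ.symm i0 = ⟨0, by omega⟩ := by simp [hi0]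
  have hs1 : σ.symm i1 = ⟨1, by omega⟩ := by simp [hi1]
  have h01 : i0 ≠ i1 := by
    intro h; have := σ.injective h; simp at this
  have hv0 : ∀ a b, v i0 a = v i0 b := by
    apply hconst
    rw [hPv, hs0]; simp [h0]
  obtain ⟨a0⟩ : Nonempty ι := ⟨i0⟩
  have hv0c : ∀ f : ι → ℝ, v i0 ⬝ᵥ f = v i0 a0 * ∑ a, f a := by
    intro f
    rw [dotProduct, mul_sum]
    exact sum_congr rfl fun a _ => by rw [hv0 a a0]
  have hv0n : v i0 a0 ≠ 0 := by
    intro h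
    have := horth i0 i0
    rw [hv0c, h] at this; simp at this
  have h1s : ∑ a, v i1 a = 0 := by
    have := horth i0 i1
    rw [hv0c, if_neg h01] at this
    exact (mul_eq_zero.1 this).resolve_left hv0n
  have hle : lam 1 ≤ 1 := h0 ▸ hanti (by norm_num)
  refine ⟨lt_of_le_of_ne hle ?_, ⟨v i1, ?_, h1s, ?_⟩, ?_⟩
  · intro h
    have hc := hconst (v i1) (by rw [hPv, hs1]; simp [h])
    have : ∑ a, v i1 a = Fintype.card ι * v i1 a0 := by
      rw [sum_congr rfl fun a _ => hc a a0]; simp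
    rw [h1s] at this
    have hz : v i1 a0 = 0 := by
      rcases mul_eq_zero.1 this.symm with h | h
      · norm_cast at h; omega
      · exact h
    have h2 := horth i1 i1
    have : v i1 = 0 := by ext a; rw [hc a a0, hz]; rfl
    rw [this] at h2; simp at h2
  · rw [horth]; simp
  · rw [hPv, hs1]
  · intro f hf
    have hPf : ∀ i, v i ⬝ᵥ (P *ᵥ f) = lam (σ.symm i) * (v i ⬝ᵥ f) := by
      intro i
      rw [dotProduct_mulVec, ← mulVec_transpose, hT, hPv, smul_dotProduct, smul_eq_mul]
    rw [hpars f (P *ᵥ f), hpars f f, mul_sum]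
    refine sum_le_sum fun i _ => ?_
    rw [hPf, dotProduct_comm f (v i)]
    by_cases hi : i = i0
    · subst hi; rw [hv0c, hf]; simp
    · have : lam (σ.symm i) ≤ lam 1 := by
        apply hanti
        by_contra hlt
        apply hi
        have : σ.symm i = ⟨0, by omega⟩ := by ext; simp; omega
        rw [hi0, ← this]; simp
      nlinarith [mul_self_nonneg (v i ⬝ᵥ f)]

/-- Dirichlet sum. -/
noncomputable def dirS {ι : Type*} [Fintype ι] (P : Matrix ι ι ℝ) (f : ι → ℝ) : ℝ :=
  ∑ a, ∑ b, P a b * (f a - f b)^2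

lemma dir_eq {ι : Type*} [Fintype ι] (P : Matrix ι ι ℝ) (hs : ∀ a b, P a b = P b a)
    (hrow : ∀ a, ∑ b, P a b = 1) (f : ι → ℝ) :
    dirS P f = 2 * (f ⬝ᵥ f - f ⬝ᵥ (P *ᵥ f)) := by
  have e : ∀ a b, P a b * (f a - f b)^2 = P a b * f a^2 + P b a * f b^2 - 2 * (f a * (P a b * f b)) := by
    intro a b; rw [hs b a]; ring
  unfold dirS
  simp only [e, sum_sub_distrib, sum_add_distrib]
  rw [sum_comm (f := fun a b => P b a * f b^2)]
  simp only [← sum_mul, hrow, ← mul_sum, dotProduct, mulVec]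
  simp only [one_mul, pow_two]
  ring

lemma const_of_dir {ι : Type*} [Fintype ι] [DecidableEq ι] (P : Matrix ι ι ℝ) (hnn : ∀ a b, a ≠ b → 0 ≤ P a b)
    (hirr : ∀ a b, ∃ t : ℕ, 0 < (P ^ t) a b) (f : ι → ℝ) (hd : dirS P f = 0) : ∀ a b, f a = f b := by
  have hn : ∀ a b, 0 ≤ P a b * (f a - f b)^2 := by
    intro a b
    by_cases h : a = b
    · subst h; simp
    · exact mul_nonneg (hnn a b h) (sq_nonneg _)
  have h1 : ∀ a b, P a b ≠ 0 → f a = f b := by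
    intro a b hab
    have h2 := (sum_eq_zero_iff_of_nonneg (fun a _ => sum_nonneg (fun b _ => hn a b))).1 hd a (mem_univ _)
    have h3 := (sum_eq_zero_iff_of_nonneg (fun b _ => hn a b)).1 h2 b (mem_univ _)
    have := (mul_eq_zero.1 h3).resolve_left hab
    have := pow_eq_zero_iff (two_ne_zero) |>.1 this
    linarith
  have h2 : ∀ t : ℕ, ∀ a b, (P ^ t) a b ≠ 0 → f a = f b := by
    intro t
    induction t with
    | zero =>
      intro a b h
      by_cases hab : a = b
      · rw [hab]
      · simp [Matrix.one_apply, hab] at h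
    | succ t ih =>
      intro a b h
      rw [pow_succ, Matrix.mul_apply] at h
      obtain ⟨c, -, hc⟩ := exists_ne_zero_of_sum_ne_zero h
      exact (ih a c (left_ne_zero_of_mul hc)).trans (h1 c b (right_ne_zero_of_mul hc))
  intro a b
  obtain ⟨t, ht⟩ := hirr a b
  exact h2 t a b ht.ne'

/-- Abstract comparison of two chains. -/
lemma compare_gap {ι : Type*} [Fintype ι] [DecidableEq ι] (P Q : Matrix ι ι ℝ)
    (hsP : ∀ a b, P a b = P b a) (hsQ : ∀ a b, Q a b = Q b a)
    (hrP : ∀ a, ∑ b, P a b = 1) (hrQ : ∀ a, ∑ b, Q a b = 1)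
    (hnn : ∀ a b, a ≠ b → 0 ≤ P a b)
    (hirr : ∀ a b, ∃ t : ℕ, 0 < (P ^ t) a b)
    (hcard : 2 ≤ Fintype.card ι) (γ κ : ℝ) (hκ : 0 < κ)
    (h1 : ∀ f, γ * dirS Q f ≤ dirS P f) (h2 : ∀ f, dirS P f ≤ κ * dirS Q f)
    (lamP lamQ : ℕ → ℝ) (hPanti : Antitone lamP) (hP0 : lamP 0 = 1)
    (hProots : P.charpoly.roots = (Multiset.range (Fintype.card ι)).map lamP)
    (hQanti : Antitone lamQ) (hQ0 : lamQ 0 = 1)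
    (hQroots : Q.charpoly.roots = (Multiset.range (Fintype.card ι)).map lamQ) :
    γ * (1 - lamP 1)⁻¹ ≤ (1 - lamQ 1)⁻¹ ∧ (1 - lamQ 1)⁻¹ ≤ κ * (1 - lamP 1)⁻¹ := by
  have hPnn : ∀ f, 0 ≤ dirS P f := by
    intro f
    refine sum_nonneg fun a _ => sum_nonneg fun b _ => ?_
    by_cases h : a = b
    · subst h; simp
    · exact mul_nonneg (hnn a b h) (sq_nonneg _)
  have hcP : ∀ f : ι → ℝ, P *ᵥ f = f → ∀ a b, f a = f b := by
    intro f hf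
    refine const_of_dir P hnn hirr f ?_
    rw [dir_eq P hsP hrP, hf]; ring
  have hcQ : ∀ f : ι → ℝ, Q *ᵥ f = f → ∀ a b, f a = f b := by
    intro f hf
    refine const_of_dir P hnn hirr f (le_antisymm ?_ (hPnn f))
    refine (h2 f).trans ?_
    rw [dir_eq Q hsQ hrQ, hf]; simp
  obtain ⟨p1, ⟨f, hf0, hf1, hf2⟩, p3⟩ := gap_spec P hsP hcard hcP lamP hPanti hP0 hProots
  obtain ⟨q1, ⟨g, hg0, hg1, hg2⟩, q3⟩ := gap_spec Q hsQ hcard hcQ lamQ hQanti hQ0 hQroots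
  have a1 := h1 f
  have a2 := h2 g
  rw [dir_eq P hsP hrP, dir_eq Q hsQ hrQ] at a1 a2
  rw [hf2, dotProduct_smul, smul_eq_mul] at a1
  rw [hg2, dotProduct_smul, smul_eq_mul] at a2
  have b1 := q3 f hf1
  have b2 := p3 g hg1
  have hp : 0 < 1 - lamP 1 := by linarith
  have hq : 0 < 1 - lamQ 1 := by linarith
  constructor
  · rcases le_or_gt γ 0 with hγ | hγ
    · exact (mul_nonpos_of_nonpos_of_nonneg hγ (inv_pos.2 hp).le).trans (inv_pos.2 hq).le
    rw [← div_eq_mul_inv, div_le_iff₀ hp, inv_mul_eq_div, le_div_iff₀ hq]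
    have : γ * (1 - lamQ 1) * (f ⬝ᵥ f) ≤ (1 - lamP 1) * (f ⬝ᵥ f) := by nlinarith
    exact le_of_mul_le_mul_right this hf0
  · rw [← div_eq_mul_inv, le_div_iff₀ hp, inv_mul_eq_div, div_le_iff₀ hq]
    have : (1 - lamP 1) * (g ⬝ᵥ g) ≤ κ * (1 - lamQ 1) * (g ⬝ᵥ g) := by nlinarith
    exact le_of_mul_le_mul_right this hg0

end Gap
section Struct
variable {m n : ℕ} {r : Fin m → ℕ} {c : Fin n → ℕ} {F : Finset (Fin m × Fin n)} {i j : Fin m}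

lemma sum_two_iff {ι : Type*} [Fintype ι] {i j : ι} (hij : i ≠ j) (a b : ι → ℕ)
    (h : ∀ k, k ≠ i → k ≠ j → a k = b k) : ∑ k, a k = ∑ k, b k ↔ a i + a j = b i + b j := by
  have key : ∀ a : ι → ℕ, ∑ k, a k = a i + (a j + ∑ k ∈ (univ.erase i).erase j, a k) := by
    intro a
    rw [add_sum_erase _ _ (by simp [hij.symm]), add_sum_erase _ _ (mem_univ i)]
  rw [key a, key b]
  have : ∑ k ∈ (univ.erase i).erase j, a k = ∑ k ∈ (univ.erase i).erase j, b k := by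
    refine sum_congr rfl fun k hk => ?_
    simp only [mem_erase, mem_univ, and_true] at hk
    exact h k hk.2 hk.1
  rw [this]; omega

lemma col_iff (hij : i ≠ j) (A B : BinMat m n) (l : Fin n)
    (h : ∀ k, k ≠ i → k ≠ j → A k l = B k l) :
    (univ.filter fun k => A k l = true).card = (univ.filter fun k => B k l = true).card ↔
      (A i l).toNat + (A j l).toNat = (B i l).toNat + (B j l).toNat := by
  have e : ∀ A : BinMat m n, (univ.filter fun k => A k l = true).card = ∑ k, (A k l).toNat := by
    intro A
    rw [card_filter]
    refine sum_congr rfl fun k _ => ?_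
    cases A k l <;> simp
  rw [e, e]
  exact sum_two_iff hij _ _ (fun k h1 h2 => by rw [h k h1 h2])

lemma row_iff (X : Finset (Fin n)) (a b : Fin n → Bool) (h : ∀ l, l ∉ X → a l = b l) :
    (univ.filter fun l => a l = true).card = (univ.filter fun l => b l = true).card ↔
      (X.filter fun l => a l = true).card = (X.filter fun l => b l = true).card := by
  have e : ∀ a : Fin n → Bool, (univ.filter fun l => a l = true).card =
      (X.filter fun l => a l = true).card + (Xᶜ.filter fun l => a l = true).card := by
    intro a
    rw [← card_union_of_disjoint, ← filter_union, union_compl]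
    exact disjoint_filter_filter disjoint_compl_right
  rw [e a, e b]
  have : (Xᶜ.filter fun l => a l = true) = (Xᶜ.filter fun l => b l = true) := by
    refine filter_congr fun l hl => ?_
    rw [h l (by simpa using hl)]
  rw [this]; omega

/-- The union of the two sets. -/
def Vs (F : Finset (Fin m × Fin n)) (i j : Fin m) (A : BinMat m n) : Finset (Fin n) :=
  Uset F i j A ∪ Lset F i j A

lemma mem_Vs {A : BinMat m n} (hA : inOmega r c F A) (l : Fin n) :
    l ∈ Vs F i j A ↔ A i l ≠ A j l ∧ (i, l) ∉ F ∧ (j, l) ∉ F := by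
  have h1 := hA.2.2 (i, l)
  have h2 := hA.2.2 (j, l)
  simp only [Vs, Uset, Lset, mem_union, mem_filter, mem_univ, true_and]
  simp only at h1 h2
  cases h3 : A i l <;> cases h4 : A j l <;> simp_all

lemma mem_U {A : BinMat m n} (hA : inOmega r c F A) (l : Fin n) :
    l ∈ Uset F i j A ↔ l ∈ Vs F i j A ∧ A i l = true := by
  rw [mem_Vs hA]
  have h1 := hA.2.2 (i, l)
  simp only [Uset, mem_filter, mem_univ, true_and]
  simp only at h1
  cases h3 : A i l <;> cases h4 : A j l <;> simp_all

lemma mem_L {A : BinMat m n} (hA : inOmega r c F A) (l : Fin n) :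
    l ∈ Lset F i j A ↔ l ∈ Vs F i j A ∧ A i l = false := by
  rw [mem_Vs hA]
  have h1 := hA.2.2 (j, l)
  simp only [Lset, mem_filter, mem_univ, true_and]
  simp only at h1
  cases h3 : A i l <;> cases h4 : A j l <;> simp_all

lemma U_eq {A : BinMat m n} (hA : inOmega r c F A) :
    Uset F i j A = (Vs F i j A).filter fun l => A i l = true := by
  ext l; rw [mem_U hA, mem_filter]

lemma L_eq {A : BinMat m n} (hA : inOmega r c F A) :
    Lset F i j A = (Vs F i j A).filter fun l => A j l = true := by
  ext l; rw [mem_L hA, mem_filter, mem_Vs hA]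
  cases h3 : A i l <;> cases h4 : A j l <;> simp_all

lemma card_Vs (A : BinMat m n) :
    (Vs F i j A).card = usize F i j A + lsize F i j A := by
  unfold Vs usize lsize
  rw [card_union_of_disjoint]
  rw [disjoint_left]
  intro l h1 h2
  simp only [Uset, Lset, mem_filter] at h1 h2
  simp [h1.2.1] at h2

lemma nb_iff {A B : BinMat m n} :
    inNbhd r c F i j A B ↔ inOmega r c F B ∧ (∀ k l, k ≠ i → k ≠ j → B k l = A k l) ∧
      ∀ l, l ∉ Vs F i j A → B i l = A i l ∧ B j l = A j l := by
  unfold inNbhd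
  refine and_congr_right fun _ => ?_
  change (∀ k l, (k, l) ∉ (({i, j} : Finset (Fin m)) ×ˢ Vs F i j A) → B k l = A k l) ↔ _
  simp only [mem_product, mem_insert, mem_singleton, not_and]
  constructor
  · intro h
    exact ⟨fun k l h1 h2 => h k l (fun h3 => by tauto),
      fun l hl => ⟨h i l (fun _ => hl), h j l (fun _ => hl)⟩⟩
  · rintro ⟨h1, h2⟩ k l h
    by_cases hi : k = i
    · subst hi; exact (h2 l (h (Or.inl rfl))).1
    · by_cases hj : k = j
      · subst hj; exact (h2 l (h (Or.inr rfl))).2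
      · exact h1 k l hi hj

lemma nb_ne (hij : i ≠ j) {A B : BinMat m n} (hA : inOmega r c F A) (h : inNbhd r c F i j A B) (l : Fin n)
    (hl : l ∈ Vs F i j A) : B i l ≠ B j l := by
  rw [nb_iff] at h
  have h1 := (col_iff hij B A l (fun k h1 h2 => h.2.1 k l h1 h2)).1 (by rw [h.1.2.1, hA.2.1])
  rw [mem_Vs hA] at hl
  revert h1 hl
  cases A i l <;> cases A j l <;> cases B i l <;> cases B j l <;> simp

lemma nb_V (hij : i ≠ j) {A B : BinMat m n} (hA : inOmega r c F A) (h : inNbhd r c F i j A B) :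
    Vs F i j B = Vs F i j A := by
  have h0 := h
  rw [nb_iff] at h
  ext l
  by_cases hl : l ∈ Vs F i j A
  · have := nb_ne hij hA h0 l hl
    simp only [hl, iff_true]
    rw [mem_Vs hA] at hl
    rw [mem_Vs h.1]
    exact ⟨this, hl.2⟩
  · have h2 := h.2.2 l hl
    rw [mem_Vs hA] at *
    rw [mem_Vs h.1, h2.1, h2.2]

lemma nb_u (hij : i ≠ j) {A B : BinMat m n} (hA : inOmega r c F A) (h : inNbhd r c F i j A B) :
    usize F i j B = usize F i j A := by
  have hV := nb_V hij hA h
  rw [nb_iff] at h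
  unfold usize
  rw [U_eq hA, U_eq h.1, hV]
  refine (row_iff _ _ _ (fun l hl => (h.2.2 l hl).1)).1 ?_
  rw [h.1.1, hA.1]

lemma nb_l (hij : i ≠ j) {A B : BinMat m n} (hA : inOmega r c F A) (h : inNbhd r c F i j A B) :
    lsize F i j B = lsize F i j A := by
  have h1 := nb_u hij hA h
  have h2 := congrArg Finset.card (nb_V hij hA h)
  rw [card_Vs, card_Vs] at h2
  omega

lemma nb_refl {A : BinMat m n} (hA : inOmega r c F A) : inNbhd r c F i j A A :=
  ⟨hA, fun _ _ _ => rfl⟩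

lemma nb_symm (hij : i ≠ j) {A B : BinMat m n} (hA : inOmega r c F A) (h : inNbhd r c F i j A B) :
    inNbhd r c F i j B A := by
  have hV := nb_V hij hA h
  rw [nb_iff] at h ⊢
  rw [hV]
  exact ⟨hA, fun k l h1 h2 => (h.2.1 k l h1 h2).symm, fun l hl => ⟨(h.2.2 l hl).1.symm, (h.2.2 l hl).2.symm⟩⟩

lemma nb_trans (hij : i ≠ j) {A B C : BinMat m n} (hA : inOmega r c F A) (h : inNbhd r c F i j A B)
    (h' : inNbhd r c F i j B C) : inNbhd r c F i j A C := by
  have hV := nb_V hij hA h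
  rw [nb_iff] at h h' ⊢
  rw [hV] at h'
  refine ⟨h'.1, fun k l h1 h2 => (h'.2.1 k l h1 h2).trans (h.2.1 k l h1 h2), fun l hl => ?_⟩
  rw [(h'.2.2 l hl).1, (h'.2.2 l hl).2]
  exact h.2.2 l hl

/-- The matrix obtained from `A` by assigning the set `S` to row `i`. -/
def appM (F : Finset (Fin m × Fin n)) (i j : Fin m) (A : BinMat m n) (S : Finset (Fin n)) : BinMat m n :=
  fun k l => if l ∈ Vs F i j A then
    (if k = i then decide (l ∈ S) else if k = j then decide (l ∉ S) else A k l) else A k l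

lemma appM_nb (hij : i ≠ j) {A : BinMat m n} (hA : inOmega r c F A) {S : Finset (Fin n)}
    (hS : S ∈ powersetCard (usize F i j A) (Vs F i j A)) : inNbhd r c F i j A (appM F i j A S) := by
  rw [mem_powersetCard] at hS
  have hoff : ∀ k l, k ≠ i → k ≠ j → appM F i j A S k l = A k l := by
    intro k l h1 h2; simp [appM, h1, h2]
  have hout : ∀ k l, l ∉ Vs F i j A → appM F i j A S k l = A k l := by
    intro k l h1; simp [appM, h1]
  have hfi : (Vs F i j A).filter (fun l => appM F i j A S i l = true) = S := by
    ext l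
    rw [mem_filter]
    constructor
    · rintro ⟨h1, h2⟩; simpa [appM, h1] using h2
    · intro h; exact ⟨hS.1 h, by simp [appM, hS.1 h, h]⟩
  have hfj : (Vs F i j A).filter (fun l => appM F i j A S j l = true) = Vs F i j A \ S := by
    ext l
    rw [mem_filter, mem_sdiff]
    refine and_congr_right fun h => ?_
    simp [appM, h, hij.symm]
  rw [nb_iff]
  refine ⟨⟨?_, ?_, ?_⟩, hoff, fun l hl => ⟨hout _ _ hl, hout _ _ hl⟩⟩
  · intro k
    by_cases hi : k = i
    · subst hi
      rw [← hA.1 k]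
      refine (row_iff _ _ _ (fun l hl => hout k l hl)).2 ?_
      rw [hfi, ← U_eq hA, hS.2]; rfl
    · by_cases hj : k = j
      · subst hj
        rw [← hA.1 k]
        refine (row_iff _ _ _ (fun l hl => hout k l hl)).2 ?_
        rw [hfj, ← L_eq hA, card_sdiff_of_subset hS.1, card_Vs, hS.2]
        simp [lsize]
      · rw [← hA.1 k]
        congr 1
        refine filter_congr fun l _ => ?_
        rw [hoff k l hi hj]
  · intro l
    rw [← hA.2.1 l]
    refine (col_iff hij _ _ l (fun k h1 h2 => hoff k l h1 h2)).2 ?_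
    by_cases hl : l ∈ Vs F i j A
    · have h3 : A i l ≠ A j l := ((mem_Vs hA l).1 hl).1
      have h4 : (A i l).toNat + (A j l).toNat = 1 := by
        revert h3; cases A i l <;> cases A j l <;> simp
      rw [h4]
      by_cases hlS : l ∈ S <;> simp [appM, hl, hij.symm, hlS]
    · rw [hout _ _ hl, hout _ _ hl]
  · rintro ⟨k, l⟩ hp
    simp only
    by_cases hl : l ∈ Vs F i j A
    · have h3 := ((mem_Vs hA l).1 hl).2
      rw [hoff]
      · exact hA.2.2 _ hp
      · rintro rfl; exact h3.1 hp
      · rintro rfl; exact h3.2 hp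
    · rw [hout _ _ hl]; exact hA.2.2 _ hp

lemma appM_U (hij : i ≠ j) {A : BinMat m n} (hA : inOmega r c F A) {S : Finset (Fin n)}
    (hS : S ∈ powersetCard (usize F i j A) (Vs F i j A)) : Uset F i j (appM F i j A S) = S := by
  have h := appM_nb hij hA hS
  rw [mem_powersetCard] at hS
  rw [U_eq h.1, nb_V hij hA h]
  ext l
  rw [mem_filter]
  constructor
  · rintro ⟨h1, h2⟩; simpa [appM, h1] using h2
  · intro h; exact ⟨hS.1 h, by simp [appM, hS.1 h, h]⟩

lemma appM_of_nb (hij : i ≠ j) {A B : BinMat m n} (hA : inOmega r c F A) (h : inNbhd r c F i j A B) :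
    appM F i j A (Uset F i j B) = B := by
  have hne := nb_ne hij hA h
  have hV := nb_V hij hA h
  have h0 := h
  rw [nb_iff] at h
  funext k l
  by_cases hl : l ∈ Vs F i j A
  · have hU : l ∈ Uset F i j B ↔ B i l = true := by rw [mem_U h.1, hV]; simp [hl]
    have := hne l hl
    by_cases hi : k = i
    · subst hi; simp [appM, hl, hU]
    · by_cases hj : k = j
      · subst hj; simp only [appM, hl, hU, if_true, if_neg hij.symm]
        revert this
        cases B i l <;> cases B k l <;> simp
      · simp [appM, hi, hj, h.2.1 k l hi hj]
  · simp only [appM, hl, if_false]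
    exact (h0.2 k l (by rw [mem_product]; exact fun h => hl h.2)).symm

lemma U_mem_of_nb (hij : i ≠ j) {A B : BinMat m n} (hA : inOmega r c F A) (h : inNbhd r c F i j A B) :
    Uset F i j B ∈ powersetCard (usize F i j A) (Vs F i j A) := by
  rw [mem_powersetCard]
  refine ⟨?_, nb_u hij hA h⟩
  rw [← nb_V hij hA h]
  exact subset_union_left

lemma class_sum (hij : i ≠ j) (A : OmegaType r c F) :
    ∃ Φ : Finset (Fin n) → OmegaType r c F,
      (∀ h : OmegaType r c F → ℝ, ∑ B : OmegaType r c F, (if inNbhd r c F i j A.val B.val then h B else 0) =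
        ∑ S ∈ powersetCard (usize F i j A.val) (Vs F i j A.val), h (Φ S)) ∧
      (∀ S ∈ powersetCard (usize F i j A.val) (Vs F i j A.val),
        inNbhd r c F i j A.val (Φ S).val ∧ Uset F i j (Φ S).val = S) := by
  have hA := A.2
  let Φ : Finset (Fin n) → OmegaType r c F := fun S =>
    if h : inOmega r c F (appM F i j A.val S) then ⟨_, h⟩ else A
  have hΦ : ∀ S ∈ powersetCard (usize F i j A.val) (Vs F i j A.val), (Φ S).val = appM F i j A.val S := by
    intro S hS
    have := (appM_nb hij hA hS).1
    simp [Φ, this]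
  refine ⟨Φ, ?_, ?_⟩
  · intro h
    rw [← sum_filter]
    refine sum_bij' (fun B _ => Uset F i j B.val) (fun S _ => Φ S) ?_ ?_ ?_ ?_ ?_
    · intro B hB
      exact U_mem_of_nb hij hA (mem_filter.1 hB).2
    · intro S hS
      rw [mem_filter, hΦ S hS]
      exact ⟨mem_univ _, appM_nb hij hA hS⟩
    · intro B hB
      apply Subtype.ext
      rw [hΦ _ (U_mem_of_nb hij hA (mem_filter.1 hB).2)]
      exact appM_of_nb hij hA (mem_filter.1 hB).2
    · intro S hS
      rw [hΦ S hS, appM_U hij hA hS]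
    · intro B hB
      congr 1
      apply Subtype.ext
      rw [hΦ _ (U_mem_of_nb hij hA (mem_filter.1 hB).2)]
      exact (appM_of_nb hij hA (mem_filter.1 hB).2).symm
  · intro S hS
    rw [hΦ S hS]
    exact ⟨appM_nb hij hA hS, appM_U hij hA hS⟩

/-- difference of the upper sets -/
def Dset (F : Finset (Fin m × Fin n)) (i j : Fin m) (A B : BinMat m n) : Finset (Fin n) :=
  Uset F i j A \ Uset F i j B ∪ Uset F i j B \ Uset F i j A

lemma mem_Dset (hij : i ≠ j) {A B : BinMat m n} (hA : inOmega r c F A) (h : inNbhd r c F i j A B) (l : Fin n) :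
    l ∈ Dset F i j A B ↔ l ∈ Vs F i j A ∧ A i l ≠ B i l := by
  unfold Dset
  rw [mem_union, mem_sdiff, mem_sdiff, mem_U hA, mem_U h.1, nb_V hij hA h]
  cases A i l <;> cases B i l <;> simp

lemma diff_eq (hij : i ≠ j) {A B : BinMat m n} (hA : inOmega r c F A) (h : inNbhd r c F i j A B) :
    ((univ : Finset (Fin m × Fin n)).filter fun p => A p.1 p.2 ≠ B p.1 p.2) =
      ({i, j} : Finset (Fin m)) ×ˢ Dset F i j A B := by
  ext ⟨k, l⟩
  simp only [mem_filter, mem_univ, true_and, mem_product, mem_insert, mem_singleton]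
  rw [mem_Dset hij hA h]
  by_cases hl : l ∈ Vs F i j A
  · have h1 := nb_ne hij hA h l hl
    have h2 := ((mem_Vs hA l).1 hl).1
    rw [nb_iff] at h
    by_cases hi : k = i
    · subst hi; simp [hl]
    · by_cases hj : k = j
      · subst hj
        simp only [hl, true_and, or_true]
        revert h1 h2
        cases A i l <;> cases B i l <;> cases A k l <;> cases B k l <;> simp
      · simp [hi, hj, h.2.1 k l hi hj]
  · simp only [hl, false_and, and_false, iff_false, not_not]
    exact (h.2 k l (by rw [mem_product]; exact fun h => hl h.2)).symm

lemma adj_iff (hij : i ≠ j) {A B : BinMat m n} (hA : inOmega r c F A) (hB : inOmega r c F B) :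
    switchAdjIJ F i j A B ↔ inNbhd r c F i j A B ∧ (Dset F i j A B).card = 2 := by
  constructor
  · rintro ⟨h1, h2, h3⟩
    have hnb : inNbhd r c F i j A B := by
      have hoff : ∀ k l, k ≠ i → k ≠ j → B k l = A k l := by
        intro k l hi hj
        by_contra hne
        have := h2 (k, l) (by simp only [mem_filter, mem_univ, true_and]; exact fun h => hne h.symm)
        simp only at this; tauto
      rw [nb_iff]
      refine ⟨hB, hoff, fun l hl => ?_⟩
      have hc := (col_iff hij B A l (fun k h1 h2 => hoff k l h1 h2)).1 (by rw [hB.2.1, hA.2.1])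
      have h3i := h3 (i, l)
      have h3j := h3 (j, l)
      simp only [mem_filter, mem_univ, true_and] at h3i h3j
      rw [mem_Vs hA] at hl
      revert hc hl h3i h3j
      cases A i l <;> cases A j l <;> cases B i l <;> cases B j l <;> simp <;> tauto
    refine ⟨hnb, ?_⟩
    rw [diff_eq hij hA hnb, card_product, card_pair hij] at h1
    omega
  · rintro ⟨hnb, hc⟩
    unfold switchAdjIJ
    rw [diff_eq hij hA hnb]
    refine ⟨?_, ?_, ?_⟩
    · rw [card_product, card_pair hij, hc]
    · intro p hp
      simpa using (mem_product.1 hp).1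
    · intro p hp
      have := (mem_product.1 hp).2
      rw [mem_Dset hij hA hnb] at this
      exact ((mem_Vs hA _).1 this.1).2

lemma adj_unique {A B : BinMat m n} (hA : inOmega r c F A) (hB : inOmega r c F B) {p q : Fin m × Fin m}
    (hp : p.1 < p.2) (hq : q.1 < q.2) (h1 : switchAdjIJ F p.1 p.2 A B) (h2 : switchAdjIJ F q.1 q.2 A B) :
    p = q := by
  obtain ⟨n1, d1⟩ := (adj_iff hp.ne hA hB).1 h1
  obtain ⟨n2, d2⟩ := (adj_iff hq.ne hA hB).1 h2
  have e := (diff_eq hp.ne hA n1).symm.trans (diff_eq hq.ne hA n2)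
  obtain ⟨l1, hl1⟩ : (Dset F p.1 p.2 A B).Nonempty := card_pos.1 (by omega)
  obtain ⟨l2, hl2⟩ : (Dset F q.1 q.2 A B).Nonempty := card_pos.1 (by omega)
  have a1 : (p.1, l1) ∈ ({q.1, q.2} : Finset (Fin m)) ×ˢ Dset F q.1 q.2 A B := by
    rw [← e]; simp [hl1]
  have a2 : (p.2, l1) ∈ ({q.1, q.2} : Finset (Fin m)) ×ˢ Dset F q.1 q.2 A B := by
    rw [← e]; simp [hl1]
  have b1 := (mem_product.1 a1).1
  have b2 := (mem_product.1 a2).1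
  simp only [mem_insert, mem_singleton] at b1 b2
  have : p.1 = q.1 ∧ p.2 = q.2 := by
    rcases b1 with b1 | b1 <;> rcases b2 with b2 | b2
    · rw [b1, b2] at hp; exact absurd hp (lt_irrefl _)
    · exact ⟨b1, b2⟩
    · rw [b1, b2] at hp; exact absurd hp (not_lt.2 hq.le)
    · rw [b1, b2] at hp; exact absurd hp (lt_irrefl _)
  exact Prod.ext this.1 this.2

lemma adj_symm {A B : BinMat m n} (h : switchAdjIJ F i j A B) : switchAdjIJ F i j B A := by
  unfold switchAdjIJ at *
  simp only [ne_comm (a := B _ _)]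
  exact h

end Struct
section Comp
variable {m n : ℕ} {r : Fin m → ℕ} {c : Fin n → ℕ} {F : Finset (Fin m × Fin n)} {i j : Fin m}

/-- size of the binomial neighborhood -/
noncomputable def Nb (F : Finset (Fin m × Fin n)) (i j : Fin m) (A : BinMat m n) : ℝ :=
  ((usize F i j A + lsize F i j A).choose (usize F i j A) : ℝ)

lemma Nb_pos (A : BinMat m n) : 0 < Nb F i j A := by
  unfold Nb; exact_mod_cast Nat.choose_pos (by omega)

lemma Nb_nb (hij : i ≠ j) {A B : BinMat m n} (hA : inOmega r c F A) (h : inNbhd r c F i j A B) :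
    Nb F i j B = Nb F i j A := by
  unfold Nb; rw [nb_u hij hA h, nb_l hij hA h]

lemma nb_count (hij : i ≠ j) (A : OmegaType r c F) :
    ∑ B : OmegaType r c F, (if inNbhd r c F i j A.val B.val then (1:ℝ) else 0) = Nb F i j A.val := by
  obtain ⟨Φ, h1, -⟩ := class_sum hij A
  rw [h1 (fun _ => 1)]
  simp [Nb, card_Vs]

lemma adj_count (hij : i ≠ j) (A : OmegaType r c F) :
    ∑ B : OmegaType r c F, (if switchAdjIJ F i j A.val B.val then (1:ℝ) else 0) =
      (usize F i j A.val : ℝ) * lsize F i j A.val := by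
  obtain ⟨Φ, h1, h2⟩ := class_sum hij A
  have e : ∀ B : OmegaType r c F, (if switchAdjIJ F i j A.val B.val then (1:ℝ) else 0) =
      if inNbhd r c F i j A.val B.val then (if (Dset F i j A.val B.val).card = 2 then 1 else 0) else 0 := by
    intro B
    rw [adj_iff hij A.2 B.2]
    by_cases h : inNbhd r c F i j A.val B.val <;> simp [h]
  simp only [e]
  rw [h1 (fun B => if (Dset F i j A.val B.val).card = 2 then 1 else 0)]
  have hU := U_mem_of_nb hij A.2 (nb_refl A.2)
  have := sum_symm_two _ _ _ hU (fun _ => (1:ℝ))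
  rw [sum_congr rfl (g := fun T => if (Uset F i j A.val \ T ∪ T \ Uset F i j A.val).card = 2 then (1:ℝ) else 0), this]
  · simp only [sum_const, nsmul_eq_mul, mul_one]
    rw [card_sdiff_of_subset (mem_powersetCard.1 hU).1, card_Vs]
    simp [usize]
  · intro T hT
    unfold Dset
    rw [(h2 T hT).2]

lemma avg_sum (hij : i ≠ j) (h : OmegaType r c F → ℝ) :
    ∑ A, h A = ∑ A : OmegaType r c F, (Nb F i j A.val)⁻¹ *
      ∑ B : OmegaType r c F, (if inNbhd r c F i j A.val B.val then h B else 0) := by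
  simp only [mul_sum]
  rw [sum_comm]
  refine sum_congr rfl fun B _ => ?_
  have e : ∀ A : OmegaType r c F, (Nb F i j A.val)⁻¹ * (if inNbhd r c F i j A.val B.val then h B else 0)
      = ((Nb F i j B.val)⁻¹ * h B) * (if inNbhd r c F i j B.val A.val then 1 else 0) := by
    intro A
    by_cases hn : inNbhd r c F i j A.val B.val
    · have hn' := nb_symm hij A.2 hn
      rw [if_pos hn, if_pos hn', Nb_nb hij A.2 hn]; ring
    · have hn' : ¬ inNbhd r c F i j B.val A.val := fun h => hn (nb_symm hij B.2 h)
      rw [if_neg hn, if_neg hn']; ring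
  simp only [e]
  rw [← mul_sum, nb_count hij B]
  have := (Nb_pos (F := F) (i := i) (j := j) B.val).ne'
  field_simp

/-- local Curveball Dirichlet sum at a state -/
noncomputable def hC (i j : Fin m) (f : OmegaType r c F → ℝ) (B : OmegaType r c F) : ℝ :=
  (Nb F i j B.val)⁻¹ * ∑ C : OmegaType r c F, (if inNbhd r c F i j B.val C.val then (f B - f C)^2 else 0)

/-- local switch Dirichlet sum at a state -/
noncomputable def hK (i j : Fin m) (f : OmegaType r c F → ℝ) (B : OmegaType r c F) : ℝ :=
  ∑ C : OmegaType r c F, (if switchAdjIJ F i j B.val C.val then (f B - f C)^2 else 0)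

lemma class_data (hij : i ≠ j) (f : OmegaType r c F → ℝ) (A : OmegaType r c F) :
    ∃ g : Finset (Fin n) → ℝ,
      (∑ B : OmegaType r c F, (if inNbhd r c F i j A.val B.val then hC i j f B else 0) =
        2 * (∑ S ∈ powersetCard (usize F i j A.val) (Vs F i j A.val), g S ^ 2 -
          (∑ S ∈ powersetCard (usize F i j A.val) (Vs F i j A.val), g S)^2 /
            ((Vs F i j A.val).card.choose (usize F i j A.val) : ℝ))) ∧
      (∑ B : OmegaType r c F, (if inNbhd r c F i j A.val B.val then hK i j f B else 0) =
        EJ (Vs F i j A.val) (usize F i j A.val) g) := by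
  obtain ⟨Φ, h1, h2⟩ := class_sum hij A
  refine ⟨fun S => f (Φ S), ?_, ?_⟩
  · rw [h1]
    have e : ∀ S ∈ powersetCard (usize F i j A.val) (Vs F i j A.val), hC i j f (Φ S) =
        (Nb F i j A.val)⁻¹ * ∑ T ∈ powersetCard (usize F i j A.val) (Vs F i j A.val),
          (f (Φ S) - f (Φ T))^2 := by
      intro S hS
      unfold hC
      rw [Nb_nb hij A.2 (h2 S hS).1, ← h1 (fun C => (f (Φ S) - f C)^2)]
      congr 1
      refine sum_congr rfl fun C _ => ?_
      have : inNbhd r c F i j (Φ S).val C.val ↔ inNbhd r c F i j A.val C.val :=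
        ⟨fun h => nb_trans hij A.2 (h2 S hS).1 h,
         fun h => nb_trans hij (Φ S).2 (nb_symm hij A.2 (h2 S hS).1) h⟩
      simp only [this]
    rw [sum_congr rfl e, ← mul_sum]
    have hN := (Nb_pos (F := F) (i := i) (j := j) A.val).ne'
    have hNe : ((Vs F i j A.val).card.choose (usize F i j A.val) : ℝ) = Nb F i j A.val := by
      rw [card_Vs]; rfl
    have e2 : ∀ x y : ℝ, (x - y)^2 = x ^2 + y^2 - 2 * (x * y) := by intros; ring
    simp only [e2, sum_sub_distrib, sum_add_distrib, sum_const, nsmul_eq_mul, ← mul_sum, card_powersetCard, hNe]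
    rw [← sum_mul]
    field_simp
    ring
  · rw [h1]
    unfold EJ
    refine sum_congr rfl fun S hS => ?_
    rw [← sum_symm_two _ _ S hS (fun T => (f (Φ S) - f (Φ T))^2)]
    unfold hK
    have e : ∀ C : OmegaType r c F, (if switchAdjIJ F i j (Φ S).val C.val then (f (Φ S) - f C)^2 else 0) =
        if inNbhd r c F i j A.val C.val then
          (if (Dset F i j (Φ S).val C.val).card = 2 then (f (Φ S) - f C)^2 else 0) else 0 := by
      intro C
      rw [adj_iff hij (Φ S).2 C.2]
      have : inNbhd r c F i j (Φ S).val C.val ↔ inNbhd r c F i j A.val C.val :=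
        ⟨fun h => nb_trans hij A.2 (h2 S hS).1 h,
         fun h => nb_trans hij (Φ S).2 (nb_symm hij A.2 (h2 S hS).1) h⟩
      rw [this]
      by_cases h : inNbhd r c F i j A.val C.val <;> simp [h]
    simp only [e]
    rw [h1 (fun C => if (Dset F i j (Φ S).val C.val).card = 2 then (f (Φ S) - f C)^2 else 0)]
    refine sum_congr rfl fun T hT => ?_
    unfold Dset
    rw [(h2 S hS).2, (h2 T hT).2]

lemma comp_lower (hij : i ≠ j) (f : OmegaType r c F → ℝ) :
    ∑ A, hC i j f A ≤ ∑ A, hK i j f A := by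
  rw [avg_sum hij, avg_sum hij (hK i j f)]
  refine sum_le_sum fun A _ => mul_le_mul_of_nonneg_left ?_ (inv_nonneg.2 (Nb_pos _).le)
  obtain ⟨g, e1, e2⟩ := class_data hij f A
  rw [e1, e2]
  have := johnson_poincare (Vs F i j A.val) (usize F i j A.val) g
  linarith

lemma comp_upper (hij : i ≠ j) (f : OmegaType r c F → ℝ) (κ : ℝ)
    (hκ : ∀ A : OmegaType r c F, ((usize F i j A.val : ℝ) * (lsize F i j A.val + 1) ≤ κ ∨
      (lsize F i j A.val : ℝ) * (usize F i j A.val + 1) ≤ κ)) :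
    ∑ A, hK i j f A ≤ κ * ∑ A, hC i j f A := by
  rw [avg_sum hij, avg_sum hij (hC i j f), mul_sum]
  refine sum_le_sum fun A _ => ?_
  rw [mul_left_comm]
  refine mul_le_mul_of_nonneg_left ?_ (inv_nonneg.2 (Nb_pos _).le)
  obtain ⟨g, e1, e2⟩ := class_data hij f A
  rw [e1, e2]
  have := EJ_le_var (Vs F i j A.val) (usize F i j A.val) (lsize F i j A.val) (card_Vs _).symm g κ (hκ A)
  linarith

lemma card_rowPairs (m : ℕ) : (rowPairs m).card = m.choose 2 := by
  unfold rowPairs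
  have h : (univ.filter fun p : Fin m × Fin m => p.1 < p.2).card = ∑ b : Fin m, (b : ℕ) := by
    rw [card_filter, ← univ_product_univ, sum_product_right]
    refine sum_congr rfl fun b _ => ?_
    rw [← card_filter]
    have : (univ.filter fun a : Fin m => a < b) = Finset.Iio b := by ext; simp
    rw [this, Fin.card_Iio]
  rw [h, Fin.sum_univ_eq_sum_range (fun x => x), Finset.sum_range_id, Nat.choose_two_right]

lemma rp_ne {p : Fin m × Fin m} (hp : p ∈ rowPairs m) : p.1 ≠ p.2 := (mem_filter.1 hp).2.ne

/-- KTV entries off the diagonal as a sum -/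
lemma PK_off (A B : OmegaType r c F) (h : A ≠ B) : PKTV r c F A B =
    (m.choose 2 : ℝ)⁻¹ * (2 / ((n : ℝ) * ((n : ℝ) - 1))) *
      ∑ p ∈ rowPairs m, (if switchAdjIJ F p.1 p.2 A.val B.val then (1:ℝ) else 0) := by
  simp only [PKTV, Matrix.of_apply, if_neg h]
  by_cases hex : ∃ p ∈ rowPairs m, switchAdjIJ F p.1 p.2 A.val B.val
  · rw [if_pos hex]
    obtain ⟨p, hp, hadj⟩ := hex
    rw [sum_eq_single_of_mem p hp]
    · rw [if_pos hadj, mul_one]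
    · intro q hq hqp
      rw [if_neg]
      intro h2
      exact hqp (adj_unique A.2 B.2 (mem_filter.1 hq).2 (mem_filter.1 hp).2 h2 hadj)
  · rw [if_neg hex, sum_eq_zero, mul_zero]
    intro p hp
    rw [if_neg]
    exact fun h2 => hex ⟨p, hp, h2⟩

lemma PC_off (A B : OmegaType r c F) (h : A ≠ B) : Pcurve r c F A B =
    (m.choose 2 : ℝ)⁻¹ *
      ∑ p ∈ rowPairs m, (Nb F p.1 p.2 A.val)⁻¹ * (if inNbhd r c F p.1 p.2 A.val B.val then (1:ℝ) else 0) := by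
  simp only [Pcurve, Matrix.of_apply, if_neg h, mul_sum]
  refine sum_congr rfl fun p _ => ?_
  unfold Nb
  split_ifs <;> simp

lemma not_adj_self (A : BinMat m n) : ¬ switchAdjIJ F i j A A := by
  intro h; have := h.1; simp at this

lemma PK_all (A B : OmegaType r c F) : PKTV r c F A B =
    (m.choose 2 : ℝ)⁻¹ * ∑ p ∈ rowPairs m, ((if A = B then (1 - (usize F p.1 p.2 A.val : ℝ) * (lsize F p.1 p.2 A.val : ℝ) *
            (2 / ((n : ℝ) * ((n : ℝ) - 1)))) else 0) + (2 / ((n : ℝ) * ((n : ℝ) - 1))) *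
      (if switchAdjIJ F p.1 p.2 A.val B.val then (1:ℝ) else 0)) := by
  by_cases h : A = B
  · subst h
    simp only [PKTV, Matrix.of_apply, if_true, not_adj_self, if_false, mul_zero, add_zero]
  · rw [PK_off A B h]
    simp only [if_neg h, zero_add, ← mul_sum, mul_assoc]

lemma PC_all (A B : OmegaType r c F) : Pcurve r c F A B =
    (m.choose 2 : ℝ)⁻¹ *
      ∑ p ∈ rowPairs m, (Nb F p.1 p.2 A.val)⁻¹ * (if inNbhd r c F p.1 p.2 A.val B.val then (1:ℝ) else 0) := by
  by_cases h : A = B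
  · subst h
    simp only [Pcurve, Matrix.of_apply, if_true, nb_refl A.2, mul_one, Nb]
  · exact PC_off A B h

lemma PK_symm (A B : OmegaType r c F) : PKTV r c F A B = PKTV r c F B A := by
  by_cases h : A = B
  · rw [h]
  · rw [PK_off A B h, PK_off B A (Ne.symm h)]
    congr 1
    refine sum_congr rfl fun p _ => ?_
    have : switchAdjIJ F p.1 p.2 A.val B.val ↔ switchAdjIJ F p.1 p.2 B.val A.val := ⟨adj_symm, adj_symm⟩
    simp only [this]

lemma PC_symm (A B : OmegaType r c F) : Pcurve r c F A B = Pcurve r c F B A := by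
  rw [PC_all, PC_all]
  congr 1
  refine sum_congr rfl fun p hp => ?_
  by_cases hn : inNbhd r c F p.1 p.2 A.val B.val
  · have hn' := nb_symm (rp_ne hp) A.2 hn
    rw [if_pos hn, if_pos hn', Nb_nb (rp_ne hp) A.2 hn]
  · have hn' : ¬ inNbhd r c F p.1 p.2 B.val A.val := fun h => hn (nb_symm (rp_ne hp) B.2 h)
    rw [if_neg hn, if_neg hn', mul_zero, mul_zero]

lemma PK_row (hM : (m.choose 2 : ℝ) ≠ 0) (A : OmegaType r c F) : ∑ B, PKTV r c F A B = 1 := by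
  simp only [PK_all]
  rw [← mul_sum, sum_comm, sum_congr rfl (g := fun _ => (1:ℝ))]
  · rw [sum_const, card_rowPairs, nsmul_eq_mul, mul_one, inv_mul_cancel₀ hM]
  · intro p hp
    rw [sum_add_distrib, ← mul_sum, adj_count (rp_ne hp), sum_ite_eq]
    simp only [mem_univ, if_true]
    ring

lemma PC_row (hM : (m.choose 2 : ℝ) ≠ 0) (A : OmegaType r c F) : ∑ B, Pcurve r c F A B = 1 := by
  simp only [PC_all]
  rw [← mul_sum, sum_comm, sum_congr rfl (g := fun _ => (1:ℝ))]
  · rw [sum_const, card_rowPairs, nsmul_eq_mul, mul_one, inv_mul_cancel₀ hM]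
  · intro p hp
    rw [← mul_sum, nb_count (rp_ne hp), inv_mul_cancel₀ (Nb_pos _).ne']

lemma PK_dir (f : OmegaType r c F → ℝ) : dirS (PKTV r c F) f =
    (m.choose 2 : ℝ)⁻¹ * ∑ p ∈ rowPairs m, (2 / ((n : ℝ) * ((n : ℝ) - 1))) * ∑ A, hK p.1 p.2 f A := by
  unfold dirS hK
  simp only [mul_sum]
  rw [sum_comm (s := rowPairs m)]
  refine sum_congr rfl fun A _ => ?_
  rw [sum_comm (s := rowPairs m)]
  refine sum_congr rfl fun B _ => ?_
  by_cases h : A = B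
  · subst h
    simp
  · rw [PK_off A B h, mul_sum, sum_mul]
    refine sum_congr rfl fun p _ => ?_
    split_ifs <;> ring

lemma PC_dir (f : OmegaType r c F → ℝ) : dirS (Pcurve r c F) f =
    (m.choose 2 : ℝ)⁻¹ * ∑ p ∈ rowPairs m, ∑ A, hC p.1 p.2 f A := by
  unfold dirS hC
  simp only [mul_sum]
  rw [sum_comm (s := rowPairs m)]
  refine sum_congr rfl fun A _ => ?_
  rw [sum_comm (s := rowPairs m)]
  refine sum_congr rfl fun B _ => ?_
  rw [PC_all A B, mul_sum, sum_mul]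
  refine sum_congr rfl fun p _ => ?_
  split_ifs <;> ring

end Comp
section Final
variable {m n : ℕ} {r : Fin m → ℕ} {c : Fin n → ℕ} {F : Finset (Fin m × Fin n)} {i j : Fin m}

lemma choose_ne_zero (hcard : 2 ≤ Fintype.card (OmegaType r c F))
    (hirr : ∀ A B : OmegaType r c F, ∃ t : ℕ, 0 < ((PKTV r c F) ^ t) A B) :
    (m.choose 2 : ℝ) ≠ 0 := by
  intro h0
  have hP : PKTV r c F = 0 := by
    ext A B
    rw [PK_all, h0, inv_zero, zero_mul]; rfl
  have : Nontrivial (OmegaType r c F) := Fintype.one_lt_card_iff_nontrivial.1 hcard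
  obtain ⟨A, B, hAB⟩ := exists_pair_ne (OmegaType r c F)
  obtain ⟨t, ht⟩ := hirr A B
  rw [hP] at ht
  cases t with
  | zero =>
    rw [pow_zero, Matrix.one_apply_ne hAB] at ht
    exact lt_irrefl _ ht
  | succ t =>
    rw [pow_succ, mul_zero] at ht
    exact lt_irrefl _ ht

lemma arith_n {n k K : ℕ} (hn : 3 ≤ n) (hs : k + K ≤ n) (hk : k ≤ K) :
    (k : ℝ) * (K + 1) ≤ (n : ℝ) * ((n : ℝ) - 1) / 2 := by
  have h : 2 * (k * (K + 1)) + n ≤ n * n := by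
    rcases Nat.lt_or_ge n 5 with h5 | h5
    · have hk2 : k ≤ 2 := by omega
      interval_cases n <;> interval_cases k <;> omega
    · obtain ⟨d, rfl⟩ := Nat.exists_eq_add_of_le h5
      nlinarith [sq_nonneg ((k : ℤ) - K), sq_nonneg ((k : ℤ) - K - 1)]
  have h' : 2 * ((k : ℝ) * (K + 1)) + n ≤ n * n := by exact_mod_cast h
  linarith

lemma arith_r {R k K : ℕ} (hs : k + K ≤ 2 * R) :
    (k : ℝ) * (K + 1) ≤ (2 * (R : ℝ) + 1) ^ 2 / 4 := by
  have h' : (k : ℝ) + K ≤ 2 * R := by exact_mod_cast hs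
  have h0 : (0 : ℝ) ≤ k := by positivity
  have h1 : (0 : ℝ) ≤ K := by positivity
  nlinarith [sq_nonneg ((k : ℝ) - K - 1)]

lemma size_bound (hn : 3 ≤ n) (A : OmegaType r c F) :
    ((usize F i j A.val : ℝ) * (lsize F i j A.val + 1) ≤
        min ((n : ℝ) * ((n : ℝ) - 1) / 2) ((2 * ((Finset.univ.sup r : ℕ) : ℝ) + 1) ^ 2 / 4) ∨
      (lsize F i j A.val : ℝ) * (usize F i j A.val + 1) ≤
        min ((n : ℝ) * ((n : ℝ) - 1) / 2) ((2 * ((Finset.univ.sup r : ℕ) : ℝ) + 1) ^ 2 / 4)) := by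
  have hs : usize F i j A.val + lsize F i j A.val ≤ n := by
    rw [← card_Vs]
    exact (card_le_univ _).trans (by simp)
  have hu : usize F i j A.val ≤ univ.sup r := by
    refine le_trans ?_ (Finset.le_sup (f := r) (mem_univ i))
    rw [← A.2.1 i]
    refine card_le_card fun k hk => ?_
    simp only [Uset, mem_filter, mem_univ, true_and] at hk ⊢
    exact hk.1
  have hl : lsize F i j A.val ≤ univ.sup r := by
    refine le_trans ?_ (Finset.le_sup (f := r) (mem_univ j))
    rw [← A.2.1 j]
    refine card_le_card fun k hk => ?_
    simp only [Lset, mem_filter, mem_univ, true_and] at hk ⊢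
    exact hk.2.1
  rcases le_total (usize F i j A.val) (lsize F i j A.val) with h | h
  · exact Or.inl (le_min (arith_n hn hs h) (arith_r (by omega)))
  · exact Or.inr (le_min (arith_n hn (by omega) h) (arith_r (by omega)))

end Final

/-- for `n ≥ 3` with the KTV-switch chain irreducible, the relaxation times
of the Curveball chain and the KTV-switch chain satisfy
`(2/(n(n-1)))·(1-λ_*^KTV)⁻¹ ≤ (1-λ_*^c)⁻¹ ≤ min{1, (2 r_max + 1)²/(2n(n-1))}·(1-λ_*^KTV)⁻¹`,
where `λ_*` denotes in each case the second-largest eigenvalue (here `lam· 1`, with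
`lam·` an antitone enumeration of the eigenvalue multiset of each transition matrix). -/
theorem stmt_9 {m n : ℕ} (hn : 3 ≤ n) (r : Fin m → ℕ) (c : Fin n → ℕ)
    (F : Finset (Fin m × Fin n))
    (hcard : 2 ≤ Fintype.card (OmegaType r c F))
    (hirr : ∀ A B : OmegaType r c F, ∃ t : ℕ, 0 < ((PKTV r c F) ^ t) A B)
    (lamK lamC : ℕ → ℝ)
    (hKanti : Antitone lamK) (hK0 : lamK 0 = 1)
    (hKroots : (PKTV r c F).charpoly.roots
      = (Multiset.range (Fintype.card (OmegaType r c F))).map lamK)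
    (hCanti : Antitone lamC) (hC0 : lamC 0 = 1)
    (hCroots : (Pcurve r c F).charpoly.roots
      = (Multiset.range (Fintype.card (OmegaType r c F))).map lamC) :
    (2 / ((n : ℝ) * ((n : ℝ) - 1))) * (1 - lamK 1)⁻¹ ≤ (1 - lamC 1)⁻¹ ∧
    (1 - lamC 1)⁻¹ ≤
      min 1 ((2 * ((Finset.univ.sup r : ℕ) : ℝ) + 1) ^ 2 / (2 * (n : ℝ) * ((n : ℝ) - 1))) *
        (1 - lamK 1)⁻¹ := by
  have hM : (m.choose 2 : ℝ) ≠ 0 := choose_ne_zero hcard hirr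
  have hn' : (3 : ℝ) ≤ n := by exact_mod_cast hn
  have hnpos : (0 : ℝ) < (n : ℝ) * ((n : ℝ) - 1) := by nlinarith
  have hγ : 0 < 2 / ((n : ℝ) * ((n : ℝ) - 1)) := by positivity
  have hM0 : 0 ≤ (m.choose 2 : ℝ)⁻¹ := by positivity
  have hden : (0 : ℝ) < 2 * (n : ℝ) * ((n : ℝ) - 1) := by nlinarith
  refine compare_gap (PKTV r c F) (Pcurve r c F) PK_symm PC_symm (PK_row hM) (PC_row hM) ?_ hirr hcard
    _ _ ?_ ?_ ?_ lamK lamC hKanti hK0 hKroots hCanti hC0 hCroots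
  · intro A B h
    rw [PK_off A B h]
    refine mul_nonneg (mul_nonneg hM0 hγ.le) (sum_nonneg fun p _ => ?_)
    split_ifs <;> norm_num
  · refine lt_min one_pos ?_
    positivity
  · intro f
    rw [PK_dir, PC_dir, mul_left_comm, mul_sum]
    refine mul_le_mul_of_nonneg_left (sum_le_sum fun p hp => ?_) hM0
    exact mul_le_mul_of_nonneg_left (comp_lower (rp_ne hp) f) hγ.le
  · intro f
    rw [PK_dir, PC_dir, mul_left_comm (min _ _), mul_sum (rowPairs m) _ (min _ _)]
    refine mul_le_mul_of_nonneg_left (sum_le_sum fun p hp => ?_) hM0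
    have hb := comp_upper (rp_ne hp) f _ (fun A => size_bound hn A)
    refine (mul_le_mul_of_nonneg_left hb hγ.le).trans (le_of_eq ?_)
    rw [← mul_assoc]
    congr 1
    rw [mul_min_of_nonneg _ _ hγ.le]
    have hn1 : (n : ℝ) - 1 ≠ 0 := by linarith
    have hn0 : (n : ℝ) ≠ 0 := by linarith
    congr 1
    · field_simp
    · field_simp
      ring
end
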